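/- arXiv:1709.07290 — 2 statements merged into one kernel-verified Lean document; each statement's English description precedes it below -/
import Mathlib

section
/- Let Ω = Ω(n,d,F) be the set of square n×n binary matrices with all row and column sums equal to d ∈ ℕ, d ≥ 1, nd ≥ 2, with forbidden entries F, and assume the edge-switch chain on Ω (with ρ = nd) is irreducible. Then (1 − λ_*^c)^{-1} ≤ ((2d+1)/(2d))²·(1 − λ_*^{edge})^{-1}, where λ_*^c and λ_*^{edge} are the second-largest eigenvalues of the Curveball and edge-switch transition matrices respectively. -/
open Finset

attribute [local instance] Classical.propDecidable

/-- A binary `m × n` matrix, with `true` representing a `1` entry. -/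
abbrev BinMat (m n : ℕ) := Fin m → Fin n → Bool

/-- `A ∈ Ω(r,c,F)`: the binary matrix `A` has row sums `r`, column sums `c`, and is zero
on the forbidden entries `F`. -/
def inOmega {m n : ℕ} (r : Fin m → ℕ) (c : Fin n → ℕ) (F : Finset (Fin m × Fin n))
    (A : BinMat m n) : Prop :=
  (∀ i : Fin m, (univ.filter fun k => A i k = true).card = r i) ∧
  (∀ k : Fin n, (univ.filter fun i => A i k = true).card = c k) ∧
  ∀ p ∈ F, A p.1 p.2 = false

/-- `U_ij(A)`: columns with a `1` in row `i`, a `0` in row `j`, and `(j,k)` not forbidden. -/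
def Uset {m n : ℕ} (F : Finset (Fin m × Fin n)) (i j : Fin m) (A : BinMat m n) :
    Finset (Fin n) :=
  univ.filter fun k => A i k = true ∧ A j k = false ∧ (j, k) ∉ F

/-- `L_ij(A)`: columns with a `0` in row `i`, a `1` in row `j`, and `(i,k)` not forbidden. -/
def Lset {m n : ℕ} (F : Finset (Fin m × Fin n)) (i j : Fin m) (A : BinMat m n) :
    Finset (Fin n) :=
  univ.filter fun k => A i k = false ∧ A j k = true ∧ (i, k) ∉ F

/-- `u_ij(A) = |U_ij(A)|`. -/
def usize {m n : ℕ} (F : Finset (Fin m × Fin n)) (i j : Fin m) (A : BinMat m n) : ℕ :=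
  (Uset F i j A).card

/-- `l_ij(A) = |L_ij(A)|`. -/
def lsize {m n : ℕ} (F : Finset (Fin m × Fin n)) (i j : Fin m) (A : BinMat m n) : ℕ :=
  (Lset F i j A).card

/-- `B ∈ N_ij(A)`: `B ∈ Ω` and `B` agrees with `A` outside `{i,j} × (U_ij(A) ∪ L_ij(A))`. -/
def inNbhd {m n : ℕ} (r : Fin m → ℕ) (c : Fin n → ℕ) (F : Finset (Fin m × Fin n))
    (i j : Fin m) (A B : BinMat m n) : Prop :=
  inOmega r c F B ∧
  ∀ k l, (k, l) ∉ (({i, j} : Finset (Fin m)) ×ˢ (Uset F i j A ∪ Lset F i j A)) →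
    B k l = A k l

/-- `A` and `B` are switch-adjacent for rows `i, j`: `A - B` has exactly four nonzero
entries, all in rows `i` and `j`, and the columns containing them have no forbidden
entries in rows `i` and `j`. -/
def switchAdjIJ {m n : ℕ} (F : Finset (Fin m × Fin n)) (i j : Fin m)
    (A B : BinMat m n) : Prop :=
  ((univ : Finset (Fin m × Fin n)).filter fun p => A p.1 p.2 ≠ B p.1 p.2).card = 4 ∧
  (∀ p ∈ (univ : Finset (Fin m × Fin n)).filter fun p => A p.1 p.2 ≠ B p.1 p.2,
    p.1 = i ∨ p.1 = j) ∧
  ∀ p ∈ (univ : Finset (Fin m × Fin n)).filter fun p => A p.1 p.2 ≠ B p.1 p.2,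
    (i, p.2) ∉ F ∧ (j, p.2) ∉ F

/-- The pairs of rows `i < j`. -/
def rowPairs (m : ℕ) : Finset (Fin m × Fin m) :=
  univ.filter fun p => p.1 < p.2

/-- The state space `Ω(r,c,F)` as a type. -/
abbrev OmegaType {m n : ℕ} (r : Fin m → ℕ) (c : Fin n → ℕ) (F : Finset (Fin m × Fin n)) :=
  {A : BinMat m n // inOmega r c F A}

/-- Transition matrix of the Curveball chain on `Ω(r,c,F)`.  (For `A ≠ B` at most one
row pair `p` satisfies `B ∈ N_p(A)`, so the sum below has at most one nonzero term.) -/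
noncomputable def Pcurve {m n : ℕ} (r : Fin m → ℕ) (c : Fin n → ℕ)
    (F : Finset (Fin m × Fin n)) :
    Matrix (OmegaType r c F) (OmegaType r c F) ℝ :=
  Matrix.of fun A B =>
    if A = B then
      (m.choose 2 : ℝ)⁻¹ *
        ∑ p ∈ rowPairs m,
          (((usize F p.1 p.2 A.val + lsize F p.1 p.2 A.val).choose
            (usize F p.1 p.2 A.val) : ℝ))⁻¹
    else
      ∑ p ∈ rowPairs m,
        if inNbhd r c F p.1 p.2 A.val B.val then
          (m.choose 2 : ℝ)⁻¹ *
            (((usize F p.1 p.2 A.val + lsize F p.1 p.2 A.val).choose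
              (usize F p.1 p.2 A.val) : ℝ))⁻¹
        else 0

/-- Transition matrix of the edge-switch chain on `Ω(r,c,F)`, where `ρ` is the total
number of ones of each matrix in `Ω(r,c,F)`: each pair of distinct switch-adjacent
matrices has transition probability `C(ρ,2)⁻¹`. -/
noncomputable def Pedge {m n : ℕ} (r : Fin m → ℕ) (c : Fin n → ℕ)
    (F : Finset (Fin m × Fin n)) (ρ : ℕ) :
    Matrix (OmegaType r c F) (OmegaType r c F) ℝ :=
  Matrix.of fun A B =>
    if A = B then
      1 - ∑ _B' ∈ univ.filter (fun B' : OmegaType r c F =>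
            B' ≠ A ∧ ∃ p ∈ rowPairs m, switchAdjIJ F p.1 p.2 A.val B'.val),
          ((ρ.choose 2 : ℝ))⁻¹
    else if ∃ p ∈ rowPairs m, switchAdjIJ F p.1 p.2 A.val B.val then
      ((ρ.choose 2 : ℝ))⁻¹
    else 0

lemma card_rowPairs (n : ℕ) : (rowPairs n).card = n.choose 2 := by
  rw [Nat.choose_two_right, ← Finset.sum_range_id_mul_two, Nat.mul_div_cancel _ (by norm_num)]
  rw [rowPairs, ← Finset.univ_product_univ, Finset.card_filter, Finset.sum_product_right]
  simp only [← Finset.card_filter]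
  rw [← Fin.sum_univ_eq_sum_range (fun i => i)]
  refine Finset.sum_congr rfl fun i _ => ?_
  have : (univ.filter fun x : Fin n => x < i) = Finset.Iio i := by ext; simp
  rw [this, Fin.card_Iio]

open Matrix in
lemma spec_data {X : Type*} [Fintype X] [DecidableEq X] (P : Matrix X X ℝ) (hP : P.IsHermitian) :
    ∃ (v : X → X → ℝ) (ev : X → ℝ),
      (∀ i j, v i ⬝ᵥ v j = if i = j then 1 else 0) ∧
      (∀ i, P *ᵥ v i = ev i • v i) ∧
      (∀ f : X → ℝ, f ⬝ᵥ f = ∑ i, (v i ⬝ᵥ f) ^ 2) ∧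
      (∀ f : X → ℝ, f ⬝ᵥ (P *ᵥ f) = ∑ i, ev i * (v i ⬝ᵥ f) ^ 2) ∧
      P.charpoly.roots = Multiset.map ev univ.val := by
  have key : ∀ f g : X → ℝ, f ⬝ᵥ g
      = ∑ i, ((hP.eigenvectorBasis i).ofLp ⬝ᵥ f) * ((hP.eigenvectorBasis i).ofLp ⬝ᵥ g) := by
    intro f g
    have := hP.eigenvectorBasis.sum_inner_mul_inner (WithLp.toLp 2 f) (WithLp.toLp 2 g)
    simp only [EuclideanSpace.inner_eq_star_dotProduct, star_trivial] at this
    rw [dotProduct_comm f g, ← this]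
    exact Finset.sum_congr rfl fun i _ => by rw [dotProduct_comm g]
  refine ⟨fun i => (hP.eigenvectorBasis i).ofLp, hP.eigenvalues, ?_, ?_, ?_, ?_, ?_⟩
  · intro i j
    have := orthonormal_iff_ite.1 hP.eigenvectorBasis.orthonormal i j
    rw [EuclideanSpace.inner_eq_star_dotProduct, star_trivial, dotProduct_comm] at this
    exact this
  · exact hP.mulVec_eigenvectorBasis
  · intro f
    rw [key f f]
    exact Finset.sum_congr rfl fun i _ => by ring
  · intro f
    rw [key f (P *ᵥ f)]
    refine Finset.sum_congr rfl fun i _ => ?_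
    have h : (hP.eigenvectorBasis i).ofLp ⬝ᵥ (P *ᵥ f)
        = hP.eigenvalues i * ((hP.eigenvectorBasis i).ofLp ⬝ᵥ f) := by
      rw [dotProduct_mulVec, ← mulVec_transpose]
      have hT : Pᵀ = P := by ext a b; simpa using hP.apply a b
      rw [hT, hP.mulVec_eigenvectorBasis, smul_dotProduct, smul_eq_mul]
    rw [h]; ring
  · rw [hP.roots_charpoly_eq_eigenvalues]; rfl

lemma two_idx {X : Type*} [Fintype X] (ev : X → ℝ) (lam : ℕ → ℝ)
    (hcard : 2 ≤ Fintype.card X) (hanti : Antitone lam)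
    (h : Multiset.map ev univ.val = (Multiset.range (Fintype.card X)).map lam) :
    ∃ i j, i ≠ j ∧ lam 1 ≤ ev i ∧ lam 1 ≤ ev j := by
  have h2 := congrArg (fun s => (s.filter (fun x => lam 1 ≤ x)).card) h
  simp only [Multiset.filter_map, Multiset.card_map] at h2
  have h3 : 2 ≤ ((Multiset.range (Fintype.card X)).filter ((fun x => lam 1 ≤ x) ∘ lam)).card := by
    have : Multiset.range 2 ≤ (Multiset.range (Fintype.card X)).filter ((fun x => lam 1 ≤ x) ∘ lam) := by
      rw [Multiset.le_filter]
      refine ⟨Multiset.range_le.2 hcard, ?_⟩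
      intro a ha
      have : a < 2 := Multiset.mem_range.1 ha
      exact hanti (by omega)
    simpa using Multiset.card_le_card this
  rw [← h2] at h3
  have h4 : 1 < (univ.filter (fun i => lam 1 ≤ ev i)).card := h3
  obtain ⟨i, hi, j, hj, hij⟩ := Finset.one_lt_card.1 h4
  exact ⟨i, j, hij, by simpa using hi, by simpa using hj⟩

lemma one_idx {X : Type*} [Fintype X] [Nonempty X] (ev : X → ℝ) (lam : ℕ → ℝ)
    (hanti : Antitone lam)
    (h : Multiset.map ev univ.val = (Multiset.range (Fintype.card X)).map lam) :
    ∃ i, ∀ j, j ≠ i → ev j ≤ lam 1 := by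
  have h2 := congrArg (fun s => (s.filter (fun x => lam 1 < x)).card) h
  simp only [Multiset.filter_map, Multiset.card_map] at h2
  have h3 : ((Multiset.range (Fintype.card X)).filter ((fun x => lam 1 < x) ∘ lam)).card ≤ 1 := by
    have : ((Finset.range (Fintype.card X)).filter ((fun x => lam 1 < x) ∘ lam)).card ≤ 1 := by
      rw [Finset.card_le_one]
      have : ∀ a ∈ ((Finset.range (Fintype.card X)).filter ((fun x => lam 1 < x) ∘ lam)), a = 0 := by
        intro a ha
        have h5 : lam 1 < lam a := (Finset.mem_filter.1 ha).2
        by_contra h0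
        exact absurd (hanti (show 1 ≤ a by omega)) (not_le.2 h5)
      intro a ha b hb
      rw [this a ha, this b hb]
    exact this
  rw [← h2] at h3
  have h4 : (univ.filter (fun i => lam 1 < ev i)).card ≤ 1 := h3
  rw [Finset.card_le_one] at h4
  by_cases hex : ∃ i, lam 1 < ev i
  · obtain ⟨i, hi⟩ := hex
    refine ⟨i, fun j hj => ?_⟩
    by_contra hc
    exact hj (h4 j (by simpa using hc) i (by simpa using hi))
  · push Not at hex
    exact ⟨Classical.arbitrary X, fun j _ => hex j⟩

open Matrix in
lemma weyl {X : Type*} [Fintype X] [DecidableEq X] (P Q : Matrix X X ℝ)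
    (hP : P.IsHermitian) (hQ : Q.IsHermitian) (hcard : 2 ≤ Fintype.card X)
    (lamP lamQ : ℕ → ℝ) (hPa : Antitone lamP) (hQa : Antitone lamQ)
    (hPr : P.charpoly.roots = (Multiset.range (Fintype.card X)).map lamP)
    (hQr : Q.charpoly.roots = (Multiset.range (Fintype.card X)).map lamQ)
    (c : ℝ) (hc : 0 ≤ c)
    (hcmp : ∀ f : X → ℝ, c * (f ⬝ᵥ f - f ⬝ᵥ (Q *ᵥ f)) ≤ f ⬝ᵥ f - f ⬝ᵥ (P *ᵥ f)) :
    c * (1 - lamQ 1) ≤ 1 - lamP 1 := by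
  obtain ⟨v, ev, vo, vm, v2, vP, vr⟩ := spec_data P hP
  obtain ⟨w, ew, wo, wm, w2, wQ, wr⟩ := spec_data Q hQ
  have : Nonempty X := Fintype.card_pos_iff.1 (by omega)
  obtain ⟨i, j, hij, hi, hj⟩ := two_idx ev lamP hcard hPa (vr ▸ hPr)
  obtain ⟨k, hk⟩ := one_idx ew lamQ hQa (wr ▸ hQr)
  obtain ⟨a, b, hab, h0⟩ : ∃ a b : ℝ, 0 < a ^ 2 + b ^ 2 ∧ a * (w k ⬝ᵥ v i) + b * (w k ⬝ᵥ v j) = 0 := by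
    by_cases h : w k ⬝ᵥ v i = 0
    · exact ⟨1, 0, by norm_num, by rw [h]; ring⟩
    · exact ⟨w k ⬝ᵥ v j, -(w k ⬝ᵥ v i),
        add_pos_of_nonneg_of_pos (sq_nonneg _) (by rw [neg_sq]; positivity), by ring⟩
  set f : X → ℝ := a • v i + b • v j with hf
  have hff : f ⬝ᵥ f = a ^ 2 + b ^ 2 := by
    simp [hf, dotProduct_add, add_dotProduct, vo, hij, hij.symm]; ring
  have hPf : f ⬝ᵥ (P *ᵥ f) = ev i * a ^ 2 + ev j * b ^ 2 := by
    simp [hf, mulVec_add, mulVec_smul, vm, dotProduct_add, add_dotProduct, vo, hij, hij.symm]; ring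
  have hkf : w k ⬝ᵥ f = 0 := by
    simp [hf, dotProduct_add]; exact h0
  have hQf : f ⬝ᵥ (Q *ᵥ f) ≤ lamQ 1 * (f ⬝ᵥ f) := by
    rw [wQ, w2, Finset.mul_sum]
    refine Finset.sum_le_sum fun l _ => ?_
    by_cases hl : l = k
    · rw [hl, hkf]; simp
    · exact mul_le_mul_of_nonneg_right (hk l hl) (sq_nonneg _)
  have h1 := hcmp f
  have h3 : lamP 1 * (f ⬝ᵥ f) ≤ f ⬝ᵥ (P *ᵥ f) := by
    rw [hPf, hff]; nlinarith [sq_nonneg a, sq_nonneg b]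
  have h4 : c * ((1 - lamQ 1) * (f ⬝ᵥ f)) ≤ c * (f ⬝ᵥ f - f ⬝ᵥ (Q *ᵥ f)) :=
    mul_le_mul_of_nonneg_left (by linarith) hc
  have h5 : (c * (1 - lamQ 1)) * (f ⬝ᵥ f) ≤ (1 - lamP 1) * (f ⬝ᵥ f) := by linarith
  exact le_of_mul_le_mul_right h5 (by rw [hff]; exact hab)

open Matrix in
/-- Dirichlet form of a symmetric matrix with unit row sums. -/
lemma dirichlet {X : Type*} [Fintype X] (Q : Matrix X X ℝ) (hs : ∀ a b, Q a b = Q b a)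
    (h1 : ∀ a, ∑ b, Q a b = 1) (f : X → ℝ) :
    f ⬝ᵥ f - f ⬝ᵥ (Q *ᵥ f) = (1 / 2) * ∑ a, ∑ b, Q a b * (f a - f b) ^ 2 := by
  have e1 : ∑ a, ∑ b, Q a b * f a ^ 2 = f ⬝ᵥ f := by
    simp only [dotProduct, ← Finset.sum_mul, h1]
    exact Finset.sum_congr rfl fun a _ => by ring
  have e2 : ∑ a, ∑ b, Q a b * f b ^ 2 = f ⬝ᵥ f := by
    rw [Finset.sum_comm, ← e1]
    exact Finset.sum_congr rfl fun a _ => Finset.sum_congr rfl fun b _ => by rw [hs]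
  have e3 : ∑ a, ∑ b, Q a b * (f a * f b) = f ⬝ᵥ (Q *ᵥ f) := by
    simp only [dotProduct, mulVec, Finset.mul_sum]
    exact Finset.sum_congr rfl fun a _ => Finset.sum_congr rfl fun b _ => by ring
  have : ∑ a, ∑ b, Q a b * (f a - f b) ^ 2
      = ∑ a, ∑ b, Q a b * f a ^ 2 + ∑ a, ∑ b, Q a b * f b ^ 2
        - 2 * ∑ a, ∑ b, Q a b * (f a * f b) := by
    simp only [Finset.mul_sum, ← Finset.sum_add_distrib, ← Finset.sum_sub_distrib]
    exact Finset.sum_congr rfl fun a _ => Finset.sum_congr rfl fun b _ => by ring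
  rw [this, e1, e2, e3]; ring

open Matrix in
lemma irr_lt {X : Type*} [Fintype X] [DecidableEq X] (Q : Matrix X X ℝ)
    (hs : ∀ a b, Q a b = Q b a) (h1 : ∀ a, ∑ b, Q a b = 1)
    (hnn : ∀ a b, a ≠ b → 0 ≤ Q a b)
    (hirr : ∀ a b, ∃ t : ℕ, 0 < (Q ^ t) a b) (hcard : 2 ≤ Fintype.card X)
    (lam : ℕ → ℝ) (ha : Antitone lam) (h0 : lam 0 = 1)
    (hr : Q.charpoly.roots = (Multiset.range (Fintype.card X)).map lam) : lam 1 < 1 := by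
  have hQ : Q.IsHermitian := by
    ext a b; simp [hs a b]
  have hle : lam 1 ≤ 1 := h0 ▸ ha (Nat.zero_le 1)
  refine lt_of_le_of_ne hle fun heq => ?_
  obtain ⟨w, ew, wo, wm, w2, wQ, wr⟩ := spec_data Q hQ
  obtain ⟨i, j, hij, hi, hj⟩ := two_idx ew lam hcard ha (wr ▸ hr)
  have hconst : ∀ i, lam 1 ≤ ew i → ∀ a b, w i a = w i b := by
    intro i hi
    have hd := dirichlet Q hs h1 (w i)
    rw [wm, dotProduct_smul, wo] at hd
    simp only [if_true, smul_eq_mul, mul_one] at hd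
    have hterm : ∀ a b, 0 ≤ Q a b * (w i a - w i b) ^ 2 := by
      intro a b
      by_cases hab : a = b
      · simp [hab]
      · exact mul_nonneg (hnn a b hab) (sq_nonneg _)
    have hsum : ∑ a, ∑ b, Q a b * (w i a - w i b) ^ 2 = 0 := by
      apply le_antisymm
      · linarith
      · exact Finset.sum_nonneg fun a _ => Finset.sum_nonneg fun b _ => hterm a b
    have hz : ∀ a b, Q a b * (w i a - w i b) ^ 2 = 0 := by
      intro a b
      have := (Finset.sum_eq_zero_iff_of_nonneg
        (fun a _ => Finset.sum_nonneg fun b _ => hterm a b)).1 hsum a (mem_univ a)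
      exact (Finset.sum_eq_zero_iff_of_nonneg (fun b _ => hterm a b)).1 this b (mem_univ b)
    have hpow : ∀ t a b, w i a ≠ w i b → (Q ^ t) a b = 0 := by
      intro t
      induction t with
      | zero =>
        intro a b hab
        have : a ≠ b := fun h => hab (by rw [h])
        simp [this]
      | succ t ih =>
        intro a b hab
        rw [pow_succ, Matrix.mul_apply]
        refine Finset.sum_eq_zero fun c _ => ?_
        by_cases hac : w i a = w i c
        · have hcb : w i c - w i b ≠ 0 := by rw [← hac]; exact sub_ne_zero.2 hab
          have := hz c b
          rcases mul_eq_zero.1 this with h | h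
          · rw [h, mul_zero]
          · exact absurd h (pow_ne_zero 2 hcb)
        · rw [ih a c hac, zero_mul]
    intro a b
    by_contra hab
    obtain ⟨t, ht⟩ := hirr a b
    rw [hpow t a b hab] at ht
    exact lt_irrefl _ ht
  have : Nonempty X := Fintype.card_pos_iff.1 (by omega)
  let x : X := Classical.arbitrary X
  have d1 : ∀ k l, lam 1 ≤ ew k → lam 1 ≤ ew l →
      w k ⬝ᵥ w l = Fintype.card X * (w k x * w l x) := by
    intro k l hk hl
    rw [dotProduct, Finset.sum_congr rfl fun a _ => by
      rw [hconst k hk a x, hconst l hl a x]]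
    simp
  have e1 := d1 i i hi hi
  have e2 := d1 j j hj hj
  have e3 := d1 i j hi hj
  rw [wo] at e1 e2 e3
  simp only [if_true, if_neg hij] at e1 e2 e3
  have n1 : w i x ≠ 0 := by intro h; simp [h] at e1
  have n2 : w j x ≠ 0 := by intro h; simp [h] at e2
  have n3 : (Fintype.card X : ℝ) ≠ 0 := by intro h; simp [h] at e1
  exact (mul_ne_zero n3 (mul_ne_zero n1 n2)) e3.symm

/-- Local comparison: swap Laplacian versus class averaging. -/
lemma abs_local {X : Type*} [Fintype X] (R adj : X → X → Prop)
    (hrefl : ∀ a, R a a) (hsymm : ∀ a b, R a b → R b a)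
    (htrans : ∀ a b c, R a b → R b c → R a c)
    (asymm : ∀ a b, adj a b → adj b a) (hadj : ∀ a b, adj a b → R a b)
    (C u l : X → ℝ) (hC : ∀ a b, R a b → C a = C b)
    (hN : ∀ a, ((univ.filter fun b => R a b).card : ℝ) ≤ C a)
    (hdeg : ∀ a, ((univ.filter fun b => adj a b).card : ℝ) ≤ u a * l a)
    (M : ℝ) (hM : ∀ a, u a * l a + u a ≤ M)
    (hpos : ∀ g : X → ℝ, 0 ≤ ∑ a, u a * g a ^ 2 + ∑ a, ∑ b, if adj a b then g a * g b else 0)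
    (f : X → ℝ) :
    (1 / 2) * ∑ a, ∑ b, (if adj a b then (f a - f b) ^ 2 else 0)
      ≤ M * (∑ a, f a ^ 2 - ∑ a, ∑ b, if R a b then (C a)⁻¹ * (f a * f b) else 0) := by
  set N : X → ℝ := fun a => ((univ.filter fun b => R a b).card : ℝ) with hNdef
  have hNpos : ∀ a, 0 < N a := by
    intro a
    have : 0 < (univ.filter fun b => R a b).card := Finset.card_pos.2 ⟨a, by simpa using hrefl a⟩
    exact Nat.cast_pos.2 this
  have hRiff : ∀ a b, R a b → ∀ c, R a c ↔ R b c := fun a b h c =>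
    ⟨fun h' => htrans _ _ _ (hsymm _ _ h) h', fun h' => htrans _ _ _ h h'⟩
  have hNinv : ∀ a b, R a b → N a = N b := by
    intro a b h
    simp only [hNdef, hRiff a b h]
  set S : X → ℝ := fun a => ∑ b, if R a b then f b else 0 with hS
  set m : X → ℝ := fun a => S a / N a with hm
  have hSinv : ∀ a b, R a b → S a = S b := by
    intro a b h
    simp only [hS, hRiff a b h]
  have hminv : ∀ a b, R a b → m a = m b := by
    intro a b h
    simp only [hm, hSinv a b h, hNinv a b h]
  have hproj : ∀ h : X → ℝ, (∀ a b, R a b → h a = h b) → ∑ a, h a * m a = ∑ a, h a * f a := by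
    intro h hh
    have e1 : ∀ a, h a * m a = ∑ b, if R a b then h b / N b * f b else 0 := by
      intro a
      simp only [hm, hS, Finset.sum_div, Finset.mul_sum]
      refine Finset.sum_congr rfl fun b _ => ?_
      split_ifs with hab
      · rw [hh a b hab, hNinv a b hab]; ring
      · simp
    rw [Finset.sum_congr rfl fun a _ => e1 a, Finset.sum_comm]
    refine Finset.sum_congr rfl fun b _ => ?_
    have : ∀ a, (R a b ↔ R b a) := fun a => ⟨hsymm _ _, hsymm _ _⟩
    simp only [this]
    rw [← Finset.sum_filter, Finset.sum_const, nsmul_eq_mul]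
    change N b * _ = _
    have := (hNpos b).ne'
    field_simp
  have hmm : ∑ a, m a * m a = ∑ a, m a * f a := hproj m hminv
  have hCpos : ∀ a, 0 < C a := fun a => lt_of_lt_of_le (hNpos a) (hN a)
  have hK : (∑ a, ∑ b, if R a b then (C a)⁻¹ * (f a * f b) else 0) ≤ ∑ a, m a * m a := by
    have e : (∑ a, ∑ b, if R a b then (C a)⁻¹ * (f a * f b) else 0)
        = ∑ a, (N a / C a * m a) * m a := by
      rw [hproj (fun a => N a / C a * m a) fun a b h => by
        rw [hC a b h, hNinv a b h, hminv a b h]]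
      refine Finset.sum_congr rfl fun a _ => ?_
      have h1 : N a / C a * m a = (C a)⁻¹ * S a := by
        simp only [hm]
        have := (hNpos a).ne'
        have := (hCpos a).ne'
        field_simp
      rw [h1, hS]
      simp only [Finset.mul_sum, Finset.sum_mul]
      refine Finset.sum_congr rfl fun b _ => ?_
      split_ifs
      · ring
      · simp
    rw [e]
    refine Finset.sum_le_sum fun a _ => ?_
    have : N a / C a ≤ 1 := (div_le_one (hCpos a)).2 (hN a)
    nlinarith [mul_self_nonneg (m a)]
  set g : X → ℝ := fun a => f a - m a with hg
  have hgg : ∑ a, g a ^ 2 ≤ ∑ a, f a ^ 2 - ∑ a, ∑ b, if R a b then (C a)⁻¹ * (f a * f b) else 0 := by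
    have : ∑ a, g a ^ 2 = ∑ a, f a ^ 2 + ∑ a, m a * m a - 2 * ∑ a, m a * f a := by
      simp only [Finset.mul_sum, ← Finset.sum_add_distrib, ← Finset.sum_sub_distrib, hg]
      exact Finset.sum_congr rfl fun a _ => by ring
    rw [this]; linarith
  have hMnn : ∀ _ : X, 0 ≤ M := by
    intro a
    by_contra hneg
    have hne : u a * l a + u a < 0 := by linarith [hM a]
    have h0 : 0 ≤ u a * l a := le_trans (Nat.cast_nonneg _) (hdeg a)
    have h1 := hpos (fun b => if b = a then 1 else 0)
    have h2 : ∑ b, u b * (if b = a then (1 : ℝ) else 0) ^ 2 = u a := by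
      simp
    have h3 : (∑ b, ∑ c, if adj b c then (if b = a then (1 : ℝ) else 0) * (if c = a then 1 else 0) else 0)
        = if adj a a then 1 else 0 := by
      rw [Finset.sum_eq_single a, Finset.sum_eq_single a]
      · simp
      · intro b _ hb; simp [hb]
      · simp
      · intro b _ hb; simp [hb]
      · simp
    rw [h2, h3] at h1
    split_ifs at h1 with haa
    · have : (1 : ℝ) ≤ ((univ.filter fun b => adj a b).card : ℝ) := by
        have : 0 < (univ.filter fun b => adj a b).card := Finset.card_pos.2 ⟨a, by simpa using haa⟩
        exact_mod_cast this
      linarith [hdeg a]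
    · linarith
  have hE : (1 / 2) * ∑ a, ∑ b, (if adj a b then (f a - f b) ^ 2 else 0)
      ≤ ∑ a, M * g a ^ 2 := by
    have e0 : ∑ a, ∑ b, (if adj a b then (f a - f b) ^ 2 else 0)
        = ∑ a, ∑ b, (if adj a b then g a ^ 2 else 0) + ∑ a, ∑ b, (if adj a b then g b ^ 2 else 0)
          - 2 * ∑ a, ∑ b, (if adj a b then g a * g b else 0) := by
      simp only [Finset.mul_sum, ← Finset.sum_add_distrib, ← Finset.sum_sub_distrib]
      refine Finset.sum_congr rfl fun a _ => Finset.sum_congr rfl fun b _ => ?_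
      split_ifs with hab
      · have := hminv a b (hadj a b hab)
        simp only [hg, this]; ring
      · ring
    have e1 : ∑ a, ∑ b, (if adj a b then g b ^ 2 else 0) = ∑ a, ∑ b, (if adj a b then g a ^ 2 else 0) := by
      rw [Finset.sum_comm]
      have : ∀ a b, (adj a b ↔ adj b a) := fun a b => ⟨asymm _ _, asymm _ _⟩
      refine Finset.sum_congr rfl fun a _ => Finset.sum_congr rfl fun b _ => ?_
      rw [if_congr (this b a) rfl rfl]
    have e2 : ∑ a, ∑ b, (if adj a b then g a ^ 2 else 0) ≤ ∑ a, u a * l a * g a ^ 2 := by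
      refine Finset.sum_le_sum fun a _ => ?_
      rw [← Finset.sum_filter, Finset.sum_const, nsmul_eq_mul]
      exact mul_le_mul_of_nonneg_right (hdeg a) (sq_nonneg _)
    have e3 := hpos g
    have e4 : ∑ a, u a * l a * g a ^ 2 + ∑ a, u a * g a ^ 2 ≤ ∑ a, M * g a ^ 2 := by
      rw [← Finset.sum_add_distrib]
      refine Finset.sum_le_sum fun a _ => ?_
      have := mul_le_mul_of_nonneg_right (hM a) (sq_nonneg (g a))
      linarith
    rw [e0, e1]; linarith
  refine hE.trans ?_
  rw [← Finset.mul_sum]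
  rcases isEmpty_or_nonempty X with hX | ⟨⟨a⟩⟩
  · simp
  · exact mul_le_mul_of_nonneg_left hgg (hMnn a)

section comb

variable {m n : ℕ} {r : Fin m → ℕ} {c : Fin n → ℕ} {F : Finset (Fin m × Fin n)}

/-- If two states agree in all rows except `i`, `j`, then in each column the
two entries in rows `i`, `j` have the same sum. -/
lemma col_fact {A B : BinMat m n} (hA : inOmega r c F A) (hB : inOmega r c F B)
    {i j : Fin m} (hij : i ≠ j) (k : Fin n) (h : ∀ a, a ≠ i → a ≠ j → B a k = A a k) :
    (B i k = A i k ∧ B j k = A j k) ∨ (A i k = true ∧ A j k = false ∧ B i k = false ∧ B j k = true)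
      ∨ (A i k = false ∧ A j k = true ∧ B i k = true ∧ B j k = false) := by
  have h1 := (hA.2.1 k).trans (hB.2.1 k).symm
  rw [Finset.card_filter, Finset.card_filter] at h1
  have hsplit : ∀ g : Fin m → ℕ, ∑ a, g a = g i + (g j + ∑ a ∈ (univ.erase i).erase j, g a) := by
    intro g
    rw [Finset.add_sum_erase _ g (by simp [hij.symm] : j ∈ univ.erase i),
      Finset.add_sum_erase _ g (mem_univ i)]
  rw [hsplit, hsplit] at h1
  have h2 : ∑ a ∈ (univ.erase i).erase j, (if A a k = true then 1 else 0)
      = ∑ a ∈ (univ.erase i).erase j, (if B a k = true then 1 else 0) := by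
    refine Finset.sum_congr rfl fun a ha => ?_
    simp only [mem_erase, mem_univ, and_true] at ha
    rw [h a ha.2 ha.1]
  rw [h2] at h1
  cases hAi : A i k <;> cases hAj : A j k <;> cases hBi : B i k <;> cases hBj : B j k <;>
    simp [hAi, hAj, hBi, hBj] at h1 ⊢ <;> omega

/-- Swap rows `i`, `j` in column `k`. -/
def flipc (i j : Fin m) (k : Fin n) (A : BinMat m n) : BinMat m n :=
  fun a b => if b = k then A (Equiv.swap i j a) b else A a b

lemma flipc_flipc (i j : Fin m) (k : Fin n) (A : BinMat m n) :
    flipc i j k (flipc i j k A) = A := by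
  funext a b
  by_cases h : b = k <;> simp [flipc, h]

lemma flipc_inj {i j : Fin m} {k : Fin n} {A B : BinMat m n} (h : flipc i j k A = flipc i j k B) :
    A = B := by
  rw [← flipc_flipc i j k A, h, flipc_flipc]

/-- Data of a key coincidence with `k ≠ k'`. -/
lemma key_data {A B : BinMat m n} {i j : Fin m} {k k' : Fin n} (hkk : k ≠ k')
    (h : flipc i j k A = flipc i j k' B) :
    B i k = A j k ∧ B j k = A i k ∧ A i k' = B j k' ∧ A j k' = B i k' ∧
    (∀ a, a ≠ i → a ≠ j → ∀ b, B a b = A a b) ∧ (∀ a b, b ≠ k → b ≠ k' → B a b = A a b) := by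
  have hh : ∀ a b, flipc i j k A a b = flipc i j k' B a b := fun a b => by rw [h]
  refine ⟨?_, ?_, ?_, ?_, ?_, ?_⟩
  · have := hh i k; simp [flipc, hkk] at this; exact this.symm
  · have := hh j k; simp [flipc, hkk] at this; exact this.symm
  · have := hh i k'; simp [flipc, hkk.symm] at this; exact this
  · have := hh j k'; simp [flipc, hkk.symm] at this; exact this
  · intro a hi hj b
    have := hh a b
    simp only [flipc, Equiv.swap_apply_of_ne_of_ne hi hj, ite_self] at this
    exact this.symm
  · intro a b hb hb'
    have := hh a b
    simp only [flipc, hb, hb', if_false] at this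
    exact this.symm

lemma adj_of_key {A B : BinMat m n} {i j : Fin m} (hij : i ≠ j)
    (hA : inOmega r c F A) (hB : inOmega r c F B) {k k' : Fin n}
    (hk : k ∈ Uset F i j A) (hk' : k' ∈ Uset F i j B) (hkk : k ≠ k')
    (h : flipc i j k A = flipc i j k' B) : switchAdjIJ F i j A B := by
  obtain ⟨h1, h2, h3, h4, h5, h6⟩ := key_data hkk h
  simp only [Uset, mem_filter, mem_univ, true_and] at hk hk'
  obtain ⟨a1, a2, a3⟩ := hk
  obtain ⟨b1, b2, b3⟩ := hk'
  have hD : ((univ : Finset (Fin m × Fin n)).filter fun p => A p.1 p.2 ≠ B p.1 p.2)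
      = ({i, j} : Finset (Fin m)) ×ˢ ({k, k'} : Finset (Fin n)) := by
    ext ⟨a, b⟩
    simp only [mem_filter, mem_univ, true_and, mem_product, mem_insert, mem_singleton]
    constructor
    · intro hne
      constructor
      · by_contra hc
        push Not at hc
        exact hne (h5 a hc.1 hc.2 b).symm
      · by_contra hc
        push Not at hc
        exact hne (h6 a b hc.1 hc.2).symm
    · rintro ⟨rfl | rfl, rfl | rfl⟩ <;> simp_all
  have F1 : (i, k) ∉ F := fun hF => by have := hA.2.2 _ hF; simp_all
  have F2 : (i, k') ∉ F := fun hF => by have := hB.2.2 _ hF; simp_all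
  rw [switchAdjIJ, hD]
  refine ⟨?_, ?_, ?_⟩
  · rw [Finset.card_product, Finset.card_pair hij, Finset.card_pair hkk]
  · intro p hp
    simp only [mem_product, mem_insert, mem_singleton] at hp
    exact hp.1
  · intro p hp
    simp only [mem_product, mem_insert, mem_singleton] at hp
    rcases hp.2 with h | h <;> rw [h]
    · exact ⟨F1, a3⟩
    · exact ⟨F2, b3⟩

lemma key_of_adj {A B : BinMat m n} {i j : Fin m} (hij : i ≠ j)
    (hA : inOmega r c F A) (hB : inOmega r c F B) (h : switchAdjIJ F i j A B) :
    ∃ k ∈ Uset F i j A, ∃ k' ∈ Uset F i j B, k ≠ k' ∧ flipc i j k A = flipc i j k' B := by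
  obtain ⟨h4, hrow, hF⟩ := h
  have hrow' : ∀ a, a ≠ i → a ≠ j → ∀ b, B a b = A a b := by
    intro a hi hj b
    by_contra hne
    have := hrow (a, b) (by simpa using fun h => hne h.symm)
    rcases this with h | h
    · exact hi h
    · exact hj h
  have hcol := fun k => col_fact hA hB hij k (fun a hi hj => hrow' a hi hj k)
  set Kp := univ.filter fun k => A i k = true ∧ B i k = false with hKp
  set Km := univ.filter fun k => A i k = false ∧ B i k = true with hKm
  have hdisj : Disjoint Kp Km := by
    rw [Finset.disjoint_left]
    intro k h1 h2
    simp [hKp, hKm] at h1 h2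
    simp [h1.1] at h2
  have hD : ((univ : Finset (Fin m × Fin n)).filter fun p => A p.1 p.2 ≠ B p.1 p.2)
      = ({i, j} : Finset (Fin m)) ×ˢ (Kp ∪ Km) := by
    ext ⟨a, b⟩
    simp only [mem_filter, mem_univ, true_and, mem_product, mem_insert, mem_singleton, mem_union,
      hKp, hKm]
    constructor
    · intro hne
      have hab : a = i ∨ a = j := by
        by_contra hc
        push Not at hc
        exact hne (hrow' a hc.1 hc.2 b).symm
      refine ⟨hab, ?_⟩
      rcases hcol b with h | h | h
      · exfalso
        rcases hab with rfl | rfl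
        · exact hne h.1.symm
        · exact hne h.2.symm
      · exact Or.inl ⟨h.1, h.2.2.1⟩
      · exact Or.inr ⟨h.1, h.2.2.1⟩
    · rintro ⟨rfl | rfl, h⟩
      · rcases h with h | h <;> simp [h]
      · rcases hcol b with h' | h' | h'
        · rcases h with h | h <;> simp [h] at h'
        · simp [h']
        · simp [h']
  rw [hD, Finset.card_product, Finset.card_pair hij, Finset.card_union_of_disjoint hdisj] at h4
  have hcards : Kp.card = Km.card := by
    have e := (hA.1 i).trans (hB.1 i).symm
    have s1 : (univ.filter fun k => A i k = true)
        = Kp ∪ univ.filter fun k => A i k = true ∧ B i k = true := by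
      ext k; simp only [hKp, mem_filter, mem_univ, true_and, mem_union]
      cases A i k <;> cases B i k <;> simp
    have s2 : (univ.filter fun k => B i k = true)
        = Km ∪ univ.filter fun k => A i k = true ∧ B i k = true := by
      ext k; simp only [hKm, mem_filter, mem_univ, true_and, mem_union]
      cases A i k <;> cases B i k <;> simp
    rw [s1, s2, Finset.card_union_of_disjoint, Finset.card_union_of_disjoint] at e
    · omega
    · rw [Finset.disjoint_left]; intro k; simp only [hKm, mem_filter]; simp_all
    · rw [Finset.disjoint_left]; intro k; simp only [hKp, mem_filter]; simp_all
  obtain ⟨k, hk⟩ := Finset.card_eq_one.1 (show Kp.card = 1 by omega)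
  obtain ⟨k', hk'⟩ := Finset.card_eq_one.1 (show Km.card = 1 by omega)
  have mk : k ∈ Kp := by rw [hk]; simp
  have mk' : k' ∈ Km := by rw [hk']; simp
  have uk : ∀ b, A i b = true ∧ B i b = false → b = k := by
    intro b hb
    have : b ∈ Kp := by simpa [hKp] using hb
    rw [hk] at this; simpa using this
  have uk' : ∀ b, A i b = false ∧ B i b = true → b = k' := by
    intro b hb
    have : b ∈ Km := by simpa [hKm] using hb
    rw [hk'] at this; simpa using this
  have pk : A i k = true ∧ B i k = false := by simpa [hKp] using mk
  have pk' : A i k' = false ∧ B i k' = true := by simpa [hKm] using mk'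
  have hkk : k ≠ k' := by
    rintro rfl
    simp [pk.1] at pk'
  have ck : A j k = false ∧ B j k = true := by
    rcases hcol k with h | h | h
    · simp [pk] at h
    · exact ⟨h.2.1, h.2.2.2⟩
    · simp [pk] at h
  have ck' : A j k' = true ∧ B j k' = false := by
    rcases hcol k' with h | h | h
    · simp [pk'] at h
    · simp [pk'] at h
    · exact ⟨h.2.1, h.2.2.2⟩
  have fk := hF (i, k) (by simp [pk])
  have fk' := hF (i, k') (by simp [pk'])
  refine ⟨k, by simp [Uset, pk, ck, fk.2], k', by simp [Uset, pk', ck', fk'.2], hkk, ?_⟩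
  funext a b
  have hoth : b ≠ k → b ≠ k' → B i b = A i b ∧ B j b = A j b := by
    intro h1 h2
    rcases hcol b with h | h | h
    · exact h
    · exact absurd (uk b ⟨h.1, h.2.2.1⟩) h1
    · exact absurd (uk' b ⟨h.1, h.2.2.1⟩) h2
  by_cases hai : a = i
  · subst hai
    by_cases hbk : b = k
    · subst hbk; simp [flipc, hkk, ck, pk]
    · by_cases hbk' : b = k'
      · subst hbk'; simp [flipc, hbk, ck', pk']
      · simp [flipc, hbk, hbk', (hoth hbk hbk').1]
  · by_cases haj : a = j
    · subst haj
      by_cases hbk : b = k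
      · subst hbk; simp [flipc, hkk, ck, pk]
      · by_cases hbk' : b = k'
        · subst hbk'; simp [flipc, hbk, ck', pk']
        · simp [flipc, hbk, hbk', (hoth hbk hbk').2]
    · simp only [flipc, Equiv.swap_apply_of_ne_of_ne hai haj, ite_self]
      exact (hrow' a hai haj b).symm

lemma switchAdj_symm {A B : BinMat m n} {i j : Fin m} (h : switchAdjIJ F i j A B) :
    switchAdjIJ F i j B A := by
  have : ((univ : Finset (Fin m × Fin n)).filter fun p => B p.1 p.2 ≠ A p.1 p.2)
      = (univ : Finset (Fin m × Fin n)).filter fun p => A p.1 p.2 ≠ B p.1 p.2 := by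
    ext p; simp only [mem_filter, ne_comm]
  rw [switchAdjIJ, this]
  exact h

lemma not_adj_self (A : BinMat m n) (i j : Fin m) : ¬ switchAdjIJ F i j A A := by
  intro h
  have := h.1
  simp at this

/-- Number of key coincidences. -/
lemma key_count (A B : OmegaType r c F) {i j : Fin m} (hij : i ≠ j) :
    (∑ k ∈ Uset F i j A.val, ∑ k' ∈ Uset F i j B.val,
      if flipc i j k A.val = flipc i j k' B.val then (1 : ℝ) else 0)
    = (if A = B then (usize F i j A.val : ℝ) else 0)
      + (if switchAdjIJ F i j A.val B.val then 1 else 0) := by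
  by_cases hAB : A = B
  · subst hAB
    rw [if_pos rfl, if_neg (not_adj_self _ _ _), add_zero, usize, ← nsmul_one, ← Finset.sum_const]
    refine Finset.sum_congr rfl fun k hk => ?_
    rw [Finset.sum_eq_single k]
    · simp
    · intro k' hk' hne
      rw [if_neg]
      intro h
      exact not_adj_self _ _ _ (adj_of_key hij A.2 A.2 hk hk' hne.symm h)
    · exact fun h => absurd hk h
  · rw [if_neg hAB, zero_add]
    have hne : ∀ k k', flipc i j k A.val = flipc i j k' B.val → k ≠ k' := by
      rintro k k' h rfl
      exact hAB (Subtype.ext (flipc_inj h))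
    by_cases hadj : switchAdjIJ F i j A.val B.val
    · rw [if_pos hadj]
      obtain ⟨k, hk, k', hk', hkk, h⟩ := key_of_adj hij A.2 B.2 hadj
      have huniq : ∀ l ∈ Uset F i j A.val, ∀ l' ∈ Uset F i j B.val,
          flipc i j l A.val = flipc i j l' B.val → l = k ∧ l' = k' := by
        intro l hl l' hl' hll
        obtain ⟨h1, h2, h3, h4, h5, h6⟩ := key_data hkk h
        obtain ⟨g1, g2, g3, g4, g5, g6⟩ := key_data (hne l l' hll) hll
        simp only [Uset, mem_filter, mem_univ, true_and] at hk hk' hl hl'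
        constructor
        · by_contra hc
          by_cases hc' : l = k'
          · subst hc'
            simp_all
          · have := h6 i l hc hc'
            simp_all
        · by_contra hc
          by_cases hc' : l' = k
          · subst hc'
            simp_all
          · have := h6 i l' hc' hc
            simp_all
      rw [Finset.sum_eq_single k, Finset.sum_eq_single k', if_pos h]
      · intro l' hl' hne'
        rw [if_neg fun hh => hne' (huniq k hk l' hl' hh).2]
      · exact fun hh => absurd hk' hh
      · intro l hl hne'
        refine Finset.sum_eq_zero fun l' hl' => ?_
        rw [if_neg fun hh => hne' (huniq l hl l' hl' hh).1]
      · exact fun hh => absurd hk hh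
    · rw [if_neg hadj]
      refine Finset.sum_eq_zero fun k hk => Finset.sum_eq_zero fun k' hk' => ?_
      rw [if_neg fun hh => hadj (adj_of_key hij A.2 B.2 hk hk' (hne _ _ hh) hh)]

lemma key_pos {i j : Fin m} (hij : i ≠ j) (g : OmegaType r c F → ℝ) :
    0 ≤ ∑ A, (usize F i j A.val : ℝ) * g A ^ 2
      + ∑ A : OmegaType r c F, ∑ B : OmegaType r c F,
        if switchAdjIJ F i j A.val B.val then g A * g B else 0 := by
  have h : ∑ A, (usize F i j A.val : ℝ) * g A ^ 2
      + (∑ A : OmegaType r c F, ∑ B : OmegaType r c F,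
        if switchAdjIJ F i j A.val B.val then g A * g B else 0)
      = ∑ A : OmegaType r c F, ∑ B : OmegaType r c F,
        (∑ k ∈ Uset F i j A.val, ∑ k' ∈ Uset F i j B.val,
          if flipc i j k A.val = flipc i j k' B.val then (1 : ℝ) else 0) * (g A * g B) := by
    rw [← Finset.sum_add_distrib]
    refine Finset.sum_congr rfl fun A _ => ?_
    have : (usize F i j A.val : ℝ) * g A ^ 2
        = ∑ B, (if A = B then (usize F i j A.val : ℝ) else 0) * (g A * g B) := by
      simp only [ite_mul, zero_mul, Finset.sum_ite_eq, mem_univ, if_true]; ring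
    rw [this, ← Finset.sum_add_distrib]
    refine Finset.sum_congr rfl fun B _ => ?_
    rw [key_count A B hij, add_mul]
    congr 1
    split_ifs <;> simp
  have h2 : (∑ A : OmegaType r c F, ∑ B : OmegaType r c F,
        (∑ k ∈ Uset F i j A.val, ∑ k' ∈ Uset F i j B.val,
          if flipc i j k A.val = flipc i j k' B.val then (1 : ℝ) else 0) * (g A * g B))
      = ∑ K : BinMat m n, (∑ A : OmegaType r c F, ∑ k ∈ Uset F i j A.val,
          if K = flipc i j k A.val then g A else 0) ^ 2 := by
    simp only [sq, Finset.sum_mul_sum]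
    symm
    rw [Finset.sum_comm]
    refine Finset.sum_congr rfl fun A _ => ?_
    rw [Finset.sum_comm]
    refine Finset.sum_congr rfl fun B _ => ?_
    rw [Finset.sum_mul, Finset.sum_comm]
    refine Finset.sum_congr rfl fun k _ => ?_
    rw [Finset.sum_mul, Finset.sum_comm]
    refine Finset.sum_congr rfl fun k' _ => ?_
    rw [Finset.sum_eq_single (flipc i j k A.val)]
    · simp
    · intro K _ hK
      rw [if_neg hK, zero_mul]
    · simp
  rw [h, h2]
  exact Finset.sum_nonneg fun K _ => sq_nonneg _

lemma mem_L_of_key {A B : BinMat m n} {i j : Fin m}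
    (hB : inOmega r c F B) {k k' : Fin n}
    (hk' : k' ∈ Uset F i j B) (hkk : k ≠ k')
    (h : flipc i j k A = flipc i j k' B) : k' ∈ Lset F i j A := by
  obtain ⟨h1, h2, h3, h4, h5, h6⟩ := key_data hkk h
  simp only [Uset, Lset, mem_filter, mem_univ, true_and] at hk' ⊢
  refine ⟨by rw [h3]; exact hk'.2.1, by rw [h4]; exact hk'.1, fun hF => ?_⟩
  have := hB.2.2 _ hF
  simp [hk'.1] at this

lemma deg_le (A : OmegaType r c F) {i j : Fin m} (hij : i ≠ j) :
    (univ.filter fun B : OmegaType r c F => switchAdjIJ F i j A.val B.val).card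
      ≤ usize F i j A.val * lsize F i j A.val := by
  rw [usize, lsize, ← Finset.card_product, ← Finset.card_map ⟨Subtype.val, Subtype.val_injective⟩]
  refine le_trans (Finset.card_le_card (t := (Uset F i j A.val ×ˢ Lset F i j A.val).image
    fun p => flipc i j p.2 (flipc i j p.1 A.val)) ?_) Finset.card_image_le
  intro B hB
  simp only [mem_map, mem_filter, mem_univ, true_and, Function.Embedding.coeFn_mk] at hB
  obtain ⟨B, hadj, rfl⟩ := hB
  obtain ⟨k, hk, k', hk', hkk, h⟩ := key_of_adj hij A.2 B.2 hadj
  rw [Finset.mem_image]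
  refine ⟨(k, k'), Finset.mem_product.2 ⟨hk, mem_L_of_key B.2 hk' hkk h⟩, ?_⟩
  simp only [h, flipc_flipc]

lemma adj_nbhd {A B : BinMat m n} {i j : Fin m} (hij : i ≠ j)
    (hA : inOmega r c F A) (hB : inOmega r c F B) (h : switchAdjIJ F i j A B) :
    inNbhd r c F i j A B := by
  obtain ⟨k, hk, k', hk', hkk, h⟩ := key_of_adj hij hA hB h
  have hL := mem_L_of_key hB hk' hkk h
  obtain ⟨h1, h2, h3, h4, h5, h6⟩ := key_data hkk h
  refine ⟨hB, fun a b hab => ?_⟩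
  simp only [mem_product, mem_insert, mem_singleton, mem_union, not_and_or, not_or] at hab
  rcases hab with hab | hab
  · exact h5 a hab.1 hab.2 b
  · exact h6 a b (fun e => hab.1 (e ▸ hk)) (fun e => hab.2 (e ▸ hL))

lemma mem_UL {A : BinMat m n} (hA : inOmega r c F A) {i j : Fin m} (k : Fin n) :
    k ∈ Uset F i j A ∪ Lset F i j A ↔ A i k ≠ A j k ∧ (i, k) ∉ F ∧ (j, k) ∉ F := by
  have h1 : (i, k) ∈ F → A i k = false := fun h => hA.2.2 _ h
  have h2 : (j, k) ∈ F → A j k = false := fun h => hA.2.2 _ h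
  simp only [Uset, Lset, mem_union, mem_filter, mem_univ, true_and]
  cases hi : A i k <;> cases hj : A j k <;> simp_all

lemma nbhd_col {A B : BinMat m n} {i j : Fin m} (hij : i ≠ j)
    (hA : inOmega r c F A) (h : inNbhd r c F i j A B) (k : Fin n) :
    (B i k = A i k ∧ B j k = A j k) ∨ (A i k = true ∧ A j k = false ∧ B i k = false ∧ B j k = true)
      ∨ (A i k = false ∧ A j k = true ∧ B i k = true ∧ B j k = false) :=
  col_fact hA h.1 hij k fun a hi hj => h.2 a k (by simp [hi, hj])

lemma nbhd_UL {A B : BinMat m n} {i j : Fin m} (hij : i ≠ j)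
    (hA : inOmega r c F A) (h : inNbhd r c F i j A B) :
    Uset F i j B ∪ Lset F i j B = Uset F i j A ∪ Lset F i j A := by
  ext k
  rw [mem_UL hA, mem_UL h.1]
  rcases nbhd_col hij hA h k with h | h | h <;> simp [h]

lemma nbhd_symm {A B : BinMat m n} {i j : Fin m} (hij : i ≠ j)
    (hA : inOmega r c F A) (h : inNbhd r c F i j A B) : inNbhd r c F i j B A := by
  refine ⟨hA, fun a b hab => ?_⟩
  rw [nbhd_UL hij hA h] at hab
  exact (h.2 a b hab).symm

lemma nbhd_trans {A B C : BinMat m n} {i j : Fin m} (hij : i ≠ j)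
    (hA : inOmega r c F A) (h : inNbhd r c F i j A B) (h' : inNbhd r c F i j B C) :
    inNbhd r c F i j A C := by
  refine ⟨h'.1, fun a b hab => ?_⟩
  rw [h'.2 a b (by rw [nbhd_UL hij hA h]; exact hab), h.2 a b hab]

lemma Uset_eq {A : BinMat m n} (hA : inOmega r c F A) (i j : Fin m) :
    Uset F i j A = (Uset F i j A ∪ Lset F i j A).filter fun k => A i k = true := by
  ext k
  simp only [mem_filter, mem_union, Uset, Lset, mem_univ, true_and]
  cases A i k <;> simp

lemma nbhd_usize {A B : BinMat m n} {i j : Fin m} (hij : i ≠ j)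
    (hA : inOmega r c F A) (h : inNbhd r c F i j A B) :
    usize F i j B = usize F i j A := by
  have e := (hA.1 i).trans (h.1.1 i).symm
  set S := Uset F i j A ∪ Lset F i j A with hS
  have key : ∀ D : BinMat m n, (univ.filter fun k => D i k = true).card
      = (S.filter fun k => D i k = true).card + (Sᶜ.filter fun k => D i k = true).card := by
    intro D
    rw [← Finset.card_union_of_disjoint, ← Finset.filter_union, Finset.union_compl]
    exact Finset.disjoint_filter_filter disjoint_compl_right
  rw [key A, key B] at e
  have e2 : (Sᶜ.filter fun k => A i k = true) = Sᶜ.filter fun k => B i k = true := by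
    refine Finset.filter_congr fun k hk => ?_
    rw [h.2 i k]
    simp only [mem_product, not_and]
    exact fun _ => Finset.mem_compl.1 hk
  rw [e2] at e
  rw [usize, usize, Uset_eq hA, Uset_eq h.1, nbhd_UL hij hA h, ← hS]
  omega

lemma UL_card (A : BinMat m n) (i j : Fin m) :
    (Uset F i j A ∪ Lset F i j A).card = usize F i j A + lsize F i j A := by
  rw [Finset.card_union_of_disjoint]
  · rfl
  · rw [Finset.disjoint_left]; intro k; simp only [Uset, Lset, mem_filter]; simp_all

lemma nbhd_lsize {A B : BinMat m n} {i j : Fin m} (hij : i ≠ j)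
    (hA : inOmega r c F A) (h : inNbhd r c F i j A B) :
    lsize F i j B = lsize F i j A := by
  have h1 := UL_card (F := F) A i j
  rw [← nbhd_UL hij hA h, UL_card, nbhd_usize hij hA h] at h1
  omega

lemma nbhd_card (A : OmegaType r c F) {i j : Fin m} (hij : i ≠ j) :
    (univ.filter fun B : OmegaType r c F => inNbhd r c F i j A.val B.val).card
      ≤ (usize F i j A.val + lsize F i j A.val).choose (usize F i j A.val) := by
  rw [← UL_card, ← Finset.card_powersetCard]
  refine Finset.card_le_card_of_injOn (fun B => Uset F i j B.val) ?_ ?_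
  · intro B hB
    have hB : inNbhd r c F i j A.val B.val := by simpa using hB
    simp only [Finset.mem_coe, Finset.mem_powersetCard]
    refine ⟨?_, nbhd_usize hij A.2 hB⟩
    rw [← nbhd_UL hij A.2 hB]
    exact Finset.subset_union_left
  · intro B hB D hD hBD
    have hB : inNbhd r c F i j A.val B.val := by simpa using hB
    have hD : inNbhd r c F i j A.val D.val := by simpa using hD
    have hBD : Uset F i j B.val = Uset F i j D.val := hBD
    apply Subtype.ext
    funext a b
    by_cases hab : (a, b) ∈ ({i, j} : Finset (Fin m)) ×ˢ (Uset F i j A.val ∪ Lset F i j A.val)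
    · simp only [mem_product, mem_insert, mem_singleton] at hab
      obtain ⟨ha, hb⟩ := hab
      have b1 := hb
      have d1 := hb
      have u : b ∈ Uset F i j B.val ↔ b ∈ Uset F i j D.val := by rw [hBD]
      rw [← nbhd_UL hij A.2 hB, mem_UL B.2] at b1
      rw [← nbhd_UL hij A.2 hD, mem_UL D.2] at d1
      simp only [Uset, mem_filter, mem_univ, true_and, b1.2.2, not_false_eq_true, and_true] at u
      have b2 := b1.1
      have d2 := d1.1
      rcases ha with rfl | rfl
      · revert u b2 d2
        cases B.val a b <;> cases B.val j b <;> cases D.val a b <;> cases D.val j b <;> simp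
      · revert u b2 d2
        cases B.val a b <;> cases B.val i b <;> cases D.val a b <;> cases D.val i b <;> simp
    · rw [hB.2 a b hab, hD.2 a b hab]

end comb

section chains

variable {m n : ℕ} (r : Fin m → ℕ) (c : Fin n → ℕ) (F : Finset (Fin m × Fin n))

lemma exAdj_symm {A B : BinMat m n} (h : ∃ p ∈ rowPairs m, switchAdjIJ F p.1 p.2 A B) :
    ∃ p ∈ rowPairs m, switchAdjIJ F p.1 p.2 B A := by
  obtain ⟨p, hp, h⟩ := h
  exact ⟨p, hp, switchAdj_symm h⟩

lemma Pedge_symm (ρ : ℕ) (A B : OmegaType r c F) :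
    Pedge r c F ρ A B = Pedge r c F ρ B A := by
  by_cases h : A = B
  · rw [h]
  · simp only [Pedge, Matrix.of_apply, if_neg h, if_neg (Ne.symm h)]
    exact if_congr ⟨exAdj_symm F, exAdj_symm F⟩ rfl rfl

lemma Pedge_sum (ρ : ℕ) (A : OmegaType r c F) : ∑ B, Pedge r c F ρ A B = 1 := by
  rw [← Finset.add_sum_erase _ _ (mem_univ A)]
  have h : ∑ B ∈ univ.erase A, Pedge r c F ρ A B
      = ∑ _B' ∈ univ.filter (fun B' : OmegaType r c F =>
            B' ≠ A ∧ ∃ p ∈ rowPairs m, switchAdjIJ F p.1 p.2 A.val B'.val),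
          ((ρ.choose 2 : ℝ))⁻¹ := by
    rw [Finset.sum_filter]
    rw [← Finset.add_sum_erase univ (fun B' => if B' ≠ A ∧ ∃ p ∈ rowPairs m, switchAdjIJ F p.1 p.2 A.val B'.val
      then ((ρ.choose 2 : ℝ))⁻¹ else 0) (mem_univ A)]
    rw [if_neg (by simp), zero_add]
    refine Finset.sum_congr rfl fun B hB => ?_
    have hne : B ≠ A := (Finset.mem_erase.1 hB).1
    simp only [Pedge, Matrix.of_apply, if_neg hne.symm]
    exact if_congr ⟨fun h => ⟨hne, h⟩, fun h => h.2⟩ rfl rfl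
  rw [h]
  simp only [Pedge, Matrix.of_apply, if_true]
  ring

lemma Pedge_nonneg (ρ : ℕ) (A B : OmegaType r c F) (h : A ≠ B) : 0 ≤ Pedge r c F ρ A B := by
  simp only [Pedge, Matrix.of_apply, if_neg h]
  split_ifs <;> positivity

open Matrix in
lemma Pedge_form (ρ : ℕ) (f : OmegaType r c F → ℝ) :
    f ⬝ᵥ f - f ⬝ᵥ (Pedge r c F ρ *ᵥ f) ≤ ((ρ.choose 2 : ℝ))⁻¹ * ∑ p ∈ rowPairs m,
      (1 / 2) * ∑ A : OmegaType r c F, ∑ B : OmegaType r c F,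
        if switchAdjIJ F p.1 p.2 A.val B.val then (f A - f B) ^ 2 else 0 := by
  rw [dirichlet _ (Pedge_symm r c F ρ) (Pedge_sum r c F ρ), ← Finset.mul_sum, ← mul_assoc,
    mul_comm _ (1 / 2 : ℝ), mul_assoc]
  refine mul_le_mul_of_nonneg_left ?_ (by norm_num)
  rw [Finset.sum_comm (s := rowPairs m), Finset.mul_sum]
  refine Finset.sum_le_sum fun A _ => ?_
  rw [Finset.sum_comm (s := rowPairs m), Finset.mul_sum]
  refine Finset.sum_le_sum fun B _ => ?_
  have hb : 0 ≤ ((ρ.choose 2 : ℝ))⁻¹ := by positivity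
  have hnn : ∀ p ∈ rowPairs m,
      0 ≤ (if switchAdjIJ F p.1 p.2 A.val B.val then (f A - f B) ^ 2 else 0) := by
    intro p _; split_ifs <;> positivity
  by_cases h : A = B
  · rw [h, sub_self]
    simp
  · simp only [Pedge, Matrix.of_apply, if_neg h]
    split_ifs with hex
    · obtain ⟨p, hp, hadj⟩ := hex
      refine mul_le_mul_of_nonneg_left ?_ hb
      have := Finset.single_le_sum hnn hp
      rwa [if_pos hadj] at this
    · rw [zero_mul]
      exact mul_nonneg hb (Finset.sum_nonneg hnn)

lemma Pcurve_apply (A B : OmegaType r c F) : Pcurve r c F A B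
    = (m.choose 2 : ℝ)⁻¹ * ∑ p ∈ rowPairs m, if inNbhd r c F p.1 p.2 A.val B.val then
      (((usize F p.1 p.2 A.val + lsize F p.1 p.2 A.val).choose
        (usize F p.1 p.2 A.val) : ℝ))⁻¹ else 0 := by
  by_cases h : A = B
  · subst h
    simp only [Pcurve, Matrix.of_apply, if_true]
    congr 1
    refine Finset.sum_congr rfl fun p _ => ?_
    rw [if_pos ⟨A.2, fun _ _ _ => rfl⟩]
  · simp only [Pcurve, Matrix.of_apply, if_neg h, Finset.mul_sum]
    refine Finset.sum_congr rfl fun p _ => ?_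
    split_ifs <;> simp

lemma Pcurve_symm (A B : OmegaType r c F) : Pcurve r c F A B = Pcurve r c F B A := by
  rw [Pcurve_apply, Pcurve_apply]
  congr 1
  refine Finset.sum_congr rfl fun p hp => ?_
  have hij : p.1 ≠ p.2 := ne_of_lt (by simpa [rowPairs] using hp)
  by_cases h : inNbhd r c F p.1 p.2 A.val B.val
  · rw [if_pos h, if_pos (nbhd_symm hij A.2 h), nbhd_usize hij A.2 h, nbhd_lsize hij A.2 h]
  · rw [if_neg h, if_neg fun h' => h (nbhd_symm hij B.2 h')]

open Matrix in
lemma Pcurve_form (hm : 2 ≤ m) (f : OmegaType r c F → ℝ) :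
    f ⬝ᵥ f - f ⬝ᵥ (Pcurve r c F *ᵥ f) = ((m.choose 2 : ℝ))⁻¹ * ∑ p ∈ rowPairs m,
      (∑ A, f A ^ 2 - ∑ A : OmegaType r c F, ∑ B : OmegaType r c F,
        if inNbhd r c F p.1 p.2 A.val B.val then
          (((usize F p.1 p.2 A.val + lsize F p.1 p.2 A.val).choose
            (usize F p.1 p.2 A.val) : ℝ))⁻¹ * (f A * f B) else 0) := by
  rw [Finset.sum_sub_distrib, Finset.sum_const, nsmul_eq_mul, card_rowPairs, mul_sub, ← mul_assoc,
    inv_mul_cancel₀ (by exact_mod_cast (Nat.choose_pos hm).ne'), one_mul]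
  congr 1
  · simp only [dotProduct]
    exact Finset.sum_congr rfl fun A _ => by ring
  · simp only [dotProduct, mulVec, Pcurve_apply]
    rw [Finset.sum_comm, Finset.mul_sum]
    refine Finset.sum_congr rfl fun A _ => ?_
    rw [Finset.sum_comm, Finset.mul_sum, Finset.mul_sum]
    refine Finset.sum_congr rfl fun B _ => ?_
    rw [Finset.mul_sum, Finset.mul_sum, Finset.sum_mul, Finset.mul_sum]
    refine Finset.sum_congr rfl fun p _ => ?_
    split_ifs
    · ring
    · simp

lemma usize_le (A : OmegaType r c F) (i j : Fin m) : usize F i j A.val ≤ r i := by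
  rw [← A.2.1 i]
  refine Finset.card_le_card fun k hk => ?_
  simp only [Uset, mem_filter, mem_univ, true_and] at hk ⊢
  exact hk.1

lemma lsize_le (A : OmegaType r c F) (i j : Fin m) : lsize F i j A.val ≤ r j := by
  rw [← A.2.1 j]
  refine Finset.card_le_card fun k hk => ?_
  simp only [Lset, mem_filter, mem_univ, true_and] at hk ⊢
  exact hk.2.1

lemma local_cmp (d : ℕ) (hr : ∀ i, r i ≤ d) {i j : Fin m} (hij : i ≠ j)
    (f : OmegaType r c F → ℝ) :
    (1 / 2) * ∑ A : OmegaType r c F, ∑ B : OmegaType r c F,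
        (if switchAdjIJ F i j A.val B.val then (f A - f B) ^ 2 else 0)
      ≤ ((d : ℝ) * (d + 1)) * (∑ A, f A ^ 2 - ∑ A : OmegaType r c F, ∑ B : OmegaType r c F,
        if inNbhd r c F i j A.val B.val then
          (((usize F i j A.val + lsize F i j A.val).choose
            (usize F i j A.val) : ℝ))⁻¹ * (f A * f B) else 0) := by
  refine abs_local (fun A B : OmegaType r c F => inNbhd r c F i j A.val B.val)
    (fun A B : OmegaType r c F => switchAdjIJ F i j A.val B.val)
    (fun A => ⟨A.2, fun _ _ _ => rfl⟩) (fun A B h => nbhd_symm hij A.2 h)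
    (fun A B C h h' => nbhd_trans hij A.2 h h') (fun A B h => switchAdj_symm h)
    (fun A B h => adj_nbhd hij A.2 B.2 h)
    (fun A => ((usize F i j A.val + lsize F i j A.val).choose (usize F i j A.val) : ℝ))
    (fun A => (usize F i j A.val : ℝ)) (fun A => (lsize F i j A.val : ℝ))
    ?_ ?_ ?_ _ ?_ (key_pos hij) f
  · intro A B h
    simp only [nbhd_usize hij A.2 h, nbhd_lsize hij A.2 h]
  · intro A
    exact_mod_cast nbhd_card A hij
  · intro A
    exact_mod_cast deg_le A hij
  · intro A
    have h1 := (usize_le r c F A i j).trans (hr i)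
    have h2 := (lsize_le r c F A i j).trans (hr j)
    have : usize F i j A.val * lsize F i j A.val + usize F i j A.val ≤ d * (d + 1) := by nlinarith
    exact_mod_cast this

open Matrix in
lemma global_cmp (hm : 2 ≤ m) (d ρ : ℕ) (hd : 1 ≤ d) (hρ : 2 ≤ ρ) (hr : ∀ i, r i ≤ d)
    (f : OmegaType r c F → ℝ) :
    ((ρ.choose 2 : ℝ) / ((m.choose 2 : ℝ) * (d * (d + 1)))) *
      (f ⬝ᵥ f - f ⬝ᵥ (Pedge r c F ρ *ᵥ f)) ≤ f ⬝ᵥ f - f ⬝ᵥ (Pcurve r c F *ᵥ f) := by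
  have ha : (0 : ℝ) < m.choose 2 := by exact_mod_cast Nat.choose_pos hm
  have hb : (0 : ℝ) < ρ.choose 2 := by exact_mod_cast Nat.choose_pos hρ
  have hM : (0 : ℝ) < (d : ℝ) * (d + 1) := by positivity
  refine (mul_le_mul_of_nonneg_left (Pedge_form r c F ρ f) (by positivity)).trans ?_
  rw [Pcurve_form r c F hm]
  have h : ∑ p ∈ rowPairs m,
      (1 / 2) * (∑ A : OmegaType r c F, ∑ B : OmegaType r c F,
        if switchAdjIJ F p.1 p.2 A.val B.val then (f A - f B) ^ 2 else 0)
      ≤ ((d : ℝ) * (d + 1)) * ∑ p ∈ rowPairs m,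
      (∑ A, f A ^ 2 - ∑ A : OmegaType r c F, ∑ B : OmegaType r c F,
        if inNbhd r c F p.1 p.2 A.val B.val then
          (((usize F p.1 p.2 A.val + lsize F p.1 p.2 A.val).choose
            (usize F p.1 p.2 A.val) : ℝ))⁻¹ * (f A * f B) else 0) := by
    rw [Finset.mul_sum]
    refine Finset.sum_le_sum fun p hp => ?_
    exact local_cmp r c F d hr (ne_of_lt (by simpa [rowPairs] using hp)) f
  refine (mul_le_mul_of_nonneg_left (mul_le_mul_of_nonneg_left h (by positivity))
    (by positivity)).trans (le_of_eq ?_)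
  generalize (∑ p ∈ rowPairs m, _ : ℝ) = T
  field_simp

end chains

/-- for `Ω(n,d,F)` the `d`-regular square `n × n` binary matrices with
forbidden entries `F` (`d ≥ 1`, `ρ = nd ≥ 2`), if the edge-switch chain is irreducible
then `(1 - λ_*^c)⁻¹ ≤ ((2d+1)/(2d))²·(1 - λ_*^edge)⁻¹`, where `λ_*` denotes in each case
the second-largest eigenvalue (given by antitone enumerations of the eigenvalues). -/
theorem stmt_12 {n d : ℕ} (hd : 1 ≤ d) (hnd : 2 ≤ n * d) (F : Finset (Fin n × Fin n))
    (hcard : 2 ≤ Fintype.card (OmegaType (fun _ : Fin n => d) (fun _ : Fin n => d) F))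
    (hirr : ∀ A B : OmegaType (fun _ : Fin n => d) (fun _ : Fin n => d) F,
      ∃ t : ℕ, 0 < ((Pedge (fun _ => d) (fun _ => d) F (n * d)) ^ t) A B)
    (lamC lamE : ℕ → ℝ)
    (hCanti : Antitone lamC) (hC0 : lamC 0 = 1)
    (hCroots : (Pcurve (fun _ : Fin n => d) (fun _ : Fin n => d) F).charpoly.roots
      = (Multiset.range
          (Fintype.card (OmegaType (fun _ : Fin n => d) (fun _ : Fin n => d) F))).map lamC)
    (hEanti : Antitone lamE) (hE0 : lamE 0 = 1)
    (hEroots : (Pedge (fun _ : Fin n => d) (fun _ : Fin n => d) F (n * d)).charpoly.roots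
      = (Multiset.range
          (Fintype.card (OmegaType (fun _ : Fin n => d) (fun _ : Fin n => d) F))).map lamE) :
    (1 - lamC 1)⁻¹ ≤ ((2 * (d : ℝ) + 1) / (2 * (d : ℝ))) ^ 2 * (1 - lamE 1)⁻¹ := by
  have hA : Nonempty (OmegaType (fun _ : Fin n => d) (fun _ : Fin n => d) F) :=
    Fintype.card_pos_iff.1 (by omega)
  obtain ⟨A⟩ := hA
  have hn0 : 0 < n := Nat.pos_of_ne_zero (by rintro rfl; simp at hnd)
  have hdn : d ≤ n := by
    have h : _ = d := A.2.1 ⟨0, hn0⟩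
    refine h.symm.le.trans ?_
    exact (Finset.card_le_univ _).trans (by simp)
  have hn : 2 ≤ n := by
    by_contra hlt
    have h1 : n = 1 := by omega
    subst h1
    omega
  have hE1 : lamE 1 < 1 := irr_lt _ (Pedge_symm _ _ F (n * d)) (Pedge_sum _ _ F (n * d))
    (Pedge_nonneg _ _ F (n * d)) hirr hcard lamE hEanti hE0 hEroots
  have hPC : (Pcurve (fun _ : Fin n => d) (fun _ : Fin n => d) F).IsHermitian := by
    ext a b; simpa using Pcurve_symm _ _ F b a
  have hPE : (Pedge (fun _ : Fin n => d) (fun _ : Fin n => d) F (n * d)).IsHermitian := by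
    ext a b; simpa using Pedge_symm _ _ F (n * d) b a
  have ha : (0 : ℝ) < n.choose 2 := by exact_mod_cast Nat.choose_pos hn
  have hb : (0 : ℝ) < (n * d).choose 2 := by exact_mod_cast Nat.choose_pos hnd
  have hd' : (1 : ℝ) ≤ d := by exact_mod_cast hd
  have hn' : (2 : ℝ) ≤ n := by exact_mod_cast hn
  set κ : ℝ := ((n * d).choose 2 : ℝ) / ((n.choose 2 : ℝ) * (d * (d + 1))) with hκ
  have hκpos : 0 < κ := by positivity
  have hw := weyl _ _ hPC hPE hcard lamC lamE hCanti hEanti hCroots hEroots κ hκpos.le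
    (global_cmp _ _ F hn d (n * d) hd hnd (fun _ => le_rfl))
  have hx : 0 < 1 - lamE 1 := by linarith
  have hinv : κ⁻¹ ≤ ((2 * (d : ℝ) + 1) / (2 * (d : ℝ))) ^ 2 := by
    have h1 : κ⁻¹ ≤ ((d : ℝ) + 1) / d := by
      rw [hκ, inv_div, div_le_div_iff₀ hb (by linarith), Nat.cast_choose_two, Nat.cast_choose_two]
      push_cast
      have : 0 ≤ (n : ℝ) * d * (d + 1) * (d - 1) :=
        mul_nonneg (by positivity) (by linarith)
      nlinarith
    refine h1.trans ?_
    rw [div_pow, div_le_div_iff₀ (by linarith) (by positivity)]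
    nlinarith
  calc (1 - lamC 1)⁻¹ ≤ (κ * (1 - lamE 1))⁻¹ := inv_anti₀ (by positivity) hw
    _ = κ⁻¹ * (1 - lamE 1)⁻¹ := by rw [mul_inv]
    _ ≤ _ := mul_le_mul_of_nonneg_right hinv (by positivity)
end

section
/- Let 1 ≤ k ≤ ⌊m/2⌋ and assume the (1-)Curveball chain and the k-Curveball chain on Ω = Ω(r,c,F) are both ergodic. Then (1/k)·(1 − λ_*^c)^{-1} ≤ (1 − λ_*^{k,c})^{-1} ≤ (1 − λ_*^c)^{-1}, where λ_*^{k,c} is the second-largest eigenvalue of the k-Curveball transition matrix and λ_*^c is the second-largest eigenvalue of the Curveball transition matrix. -/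
open Finset

attribute [local instance] Classical.propDecidable

/-- `L_k`: all sets of `k` pairwise disjoint (ordered as `i < j`) pairs of rows. -/
def kPairSets (m k : ℕ) : Finset (Finset (Fin m × Fin m)) :=
  univ.filter fun κ => κ.card = k ∧ (∀ p ∈ κ, p.1 < p.2) ∧
    ∀ p ∈ κ, ∀ q ∈ κ, p ≠ q →
      (({p.1, p.2} : Finset (Fin m)) ∩ ({q.1, q.2} : Finset (Fin m))) = ∅

/-- `tradeChain r c F l A B` : `B` is obtained from `A` by successive binomial trades
along the row pairs listed in `l`, i.e. there are `A = A₀, A₁, …, A_k = B` with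
`A_{i+1} ∈ N_{pᵢ}(Aᵢ)` for the pairs `pᵢ` of `l`. -/
def tradeChain {m n : ℕ} (r : Fin m → ℕ) (c : Fin n → ℕ) (F : Finset (Fin m × Fin n)) :
    List (Fin m × Fin m) → BinMat m n → BinMat m n → Prop
  | [], A, B => B = A
  | p :: rest, A, B => ∃ C, inNbhd r c F p.1 p.2 A C ∧ tradeChain r c F rest C B

/-- `B ∈ N_κ(A)` : `B` is obtained from `A` by one binomial trade within each of the
pairwise disjoint row pairs of `κ` (in some enumeration of `κ`). -/
def inKNbhd {m n : ℕ} (r : Fin m → ℕ) (c : Fin n → ℕ) (F : Finset (Fin m × Fin n))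
    (κ : Finset (Fin m × Fin m)) (A B : BinMat m n) : Prop :=
  ∃ l : List (Fin m × Fin m), l.Nodup ∧ l.toFinset = κ ∧ tradeChain r c F l A B

/-- Transition matrix of the `k`-Curveball chain:
`P(A,B) = Σ_{κ ∈ L_k, B ∈ N_κ(A)} |L_k|⁻¹ |N_κ(A)|⁻¹`, where
`|N_κ(A)| = Π_{(i,j) ∈ κ} C(u_ij(A) + l_ij(A), u_ij(A))`. -/
noncomputable def PkCurve {m n : ℕ} (r : Fin m → ℕ) (c : Fin n → ℕ)
    (F : Finset (Fin m × Fin n)) (k : ℕ) :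
    Matrix (OmegaType r c F) (OmegaType r c F) ℝ :=
  Matrix.of fun A B =>
    ∑ κ ∈ kPairSets m k,
      if inKNbhd r c F κ A.val B.val then
        (((kPairSets m k).card : ℝ))⁻¹ *
          ((∏ p ∈ κ, (usize F p.1 p.2 A.val + lsize F p.1 p.2 A.val).choose
            (usize F p.1 p.2 A.val) : ℕ) : ℝ)⁻¹
      else 0

section LinAlg

lemma aux_equiv {α β : Type*} [Fintype α] [Fintype β] (f : α → ℝ) (g : β → ℝ)
    (h : (univ : Finset α).val.map f = (univ : Finset β).val.map g) :
    ∃ e : α ≃ β, ∀ a, g (e a) = f a := by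
  have key : ∀ t : ℝ, Nonempty ({a // f a = t} ≃ {b // g b = t}) := by
    intro t
    have h1 := congrArg (Multiset.count t) h
    rw [Multiset.count_map, Multiset.count_map] at h1
    apply Fintype.card_eq.mp
    rw [Fintype.card_subtype, Fintype.card_subtype]
    simp only [Finset.card_def, Finset.filter_val]
    simpa only [eq_comm] using h1
  refine ⟨Equiv.ofFiberEquiv (fun t => (key t).some), fun a => ?_⟩
  exact Equiv.ofFiberEquiv_map _ a

variable {X : Type*} [Fintype X] [DecidableEq X]

lemma aux_basis (M : Matrix X X ℝ) (hM : M.IsHermitian) (lam : ℕ → ℝ)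
    (hr : M.charpoly.roots = (Multiset.range (Fintype.card X)).map lam) :
    ∃ b : OrthonormalBasis (Fin (Fintype.card X)) ℝ (EuclideanSpace ℝ X),
      ∀ i, M.mulVec (b i).ofLp = lam i • (b i).ofLp := by
  have h2 : (univ : Finset X).val.map hM.eigenvalues =
      (univ : Finset (Fin (Fintype.card X))).val.map (fun i : Fin (Fintype.card X) => lam (i : ℕ)) := by
    have h3 := hM.roots_charpoly_eq_eigenvalues
    rw [hr] at h3
    have h4 : (univ : Finset (Fin (Fintype.card X))).val.map (fun i : Fin (Fintype.card X) => lam (i : ℕ))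
        = (Multiset.range (Fintype.card X)).map lam := by
      rw [Fin.univ_val_map, Multiset.range, Multiset.map_coe]
      congr 1
      apply List.ext_getElem <;> simp
    rw [h4, h3]; rfl
  obtain ⟨e, he⟩ := aux_equiv _ _ h2
  refine ⟨hM.eigenvectorBasis.reindex e, fun i => ?_⟩
  rw [OrthonormalBasis.reindex_apply, hM.mulVec_eigenvectorBasis, ← he]
  simp

lemma aux_quad (M : Matrix X X ℝ) (hM : M.IsHermitian) {N : ℕ} (lam : ℕ → ℝ)
    (b : OrthonormalBasis (Fin N) ℝ (EuclideanSpace ℝ X))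
    (hb : ∀ i, M.mulVec (b i).ofLp = lam i • (b i).ofLp) (x : EuclideanSpace ℝ X) :
    x.ofLp ⬝ᵥ M.mulVec x.ofLp = ∑ i : Fin N, lam i * (inner ℝ (b i) x) ^ 2 := by
  have h1 : x.ofLp ⬝ᵥ M.mulVec x.ofLp = inner ℝ x (WithLp.toLp 2 (M.mulVec x.ofLp)) := by
    rw [EuclideanSpace.inner_eq_star_dotProduct]
    simp [dotProduct_comm]
  rw [h1, ← b.sum_inner_mul_inner]
  refine Finset.sum_congr rfl fun i _ => ?_
  have h2 : inner ℝ (b i) (WithLp.toLp 2 (M.mulVec x.ofLp)) = lam i * inner ℝ (b i) x := by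
    rw [EuclideanSpace.inner_eq_star_dotProduct, EuclideanSpace.inner_eq_star_dotProduct]
    simp only [star_trivial]
    rw [dotProduct_comm, Matrix.dotProduct_mulVec, ← Matrix.mulVec_transpose]
    have : M.transpose = M := by simpa [Matrix.IsHermitian] using hM
    rw [this, hb i, smul_dotProduct, smul_eq_mul, dotProduct_comm]
  rw [h2, real_inner_comm]
  ring

lemma aux_norm {N : ℕ} 
    (b : OrthonormalBasis (Fin N) ℝ (EuclideanSpace ℝ X)) (x : EuclideanSpace ℝ X) :
    x.ofLp ⬝ᵥ x.ofLp = ∑ i, (inner ℝ (b i) x) ^ 2 := by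
  have h1 : x.ofLp ⬝ᵥ x.ofLp = inner ℝ x x := by
    rw [EuclideanSpace.inner_eq_star_dotProduct]
    simp 
  rw [h1, ← b.sum_inner_mul_inner]
  refine Finset.sum_congr rfl fun i _ => ?_
  rw [real_inner_comm]
  ring

lemma second_le (M N : Matrix X X ℝ) (hM : M.IsHermitian) (hN : N.IsHermitian)
    (hc : 2 ≤ Fintype.card X) (lM lN : ℕ → ℝ) (hMa : Antitone lM) (hNa : Antitone lN)
    (hMr : M.charpoly.roots = (Multiset.range (Fintype.card X)).map lM)
    (hNr : N.charpoly.roots = (Multiset.range (Fintype.card X)).map lN)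
    (a b : ℝ) (hb : 0 ≤ b)
    (h : ∀ v : X → ℝ, v ⬝ᵥ M.mulVec v ≤ a * (v ⬝ᵥ v) + b * (v ⬝ᵥ N.mulVec v)) :
    lM 1 ≤ a + b * lN 1 := by
  obtain ⟨v, hv⟩ := aux_basis M hM lM hMr
  obtain ⟨w, hw⟩ := aux_basis N hN lN hNr
  let i0 : Fin (Fintype.card X) := ⟨0, by omega⟩
  let i1 : Fin (Fintype.card X) := ⟨1, by omega⟩
  have h01 : i0 ≠ i1 := by simp [i0, i1]
  obtain ⟨α, β, hne, horth⟩ : ∃ α β : ℝ, α ^ 2 + β ^ 2 ≠ 0 ∧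
      α * inner ℝ (w i0) (v i0) + β * inner ℝ (w i0) (v i1) = 0 := by
    by_cases hz : inner ℝ (w i0) (v i0) = 0
    · exact ⟨1, 0, by norm_num, by simp [hz]⟩
    · refine ⟨-inner ℝ (w i0) (v i1), inner ℝ (w i0) (v i0), ?_, by ring⟩
      have := sq_nonneg (-inner ℝ (w i0) (v i1))
      have := sq_pos_of_ne_zero hz
      positivity
  set x : EuclideanSpace ℝ X := α • v i0 + β • v i1 with hx
  have hv_in : ∀ i, inner ℝ (v i) x = (if i = i0 then α else 0) + (if i = i1 then β else 0) := by
    intro i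
    rw [hx, inner_add_right, inner_smul_right, inner_smul_right, 
      orthonormal_iff_ite.mp v.orthonormal, orthonormal_iff_ite.mp v.orthonormal]
    simp
  have hw0 : inner ℝ (w i0) x = 0 := by
    rw [hx, inner_add_right, inner_smul_right, inner_smul_right]; exact horth
  have hxx : 0 < x.ofLp ⬝ᵥ x.ofLp := by
    rw [aux_norm v]
    have : α ^ 2 + β ^ 2 = ∑ i ∈ {i0, i1}, (inner ℝ (v i) x) ^ 2 := by
      rw [Finset.sum_pair h01, hv_in, hv_in]; simp [h01, h01.symm]
    have h5 : α ^ 2 + β ^ 2 ≤ ∑ i, (inner ℝ (v i) x) ^ 2 := by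
      rw [this]
      exact Finset.sum_le_sum_of_subset_of_nonneg (Finset.subset_univ _) (fun i _ _ => sq_nonneg (inner ℝ (v i) x))
    exact lt_of_lt_of_le (lt_of_le_of_ne (by positivity) hne.symm) h5
  have hMx : lM 1 * (x.ofLp ⬝ᵥ x.ofLp) ≤ x.ofLp ⬝ᵥ M.mulVec x.ofLp := by
    rw [aux_quad M hM lM v hv, aux_norm v, Finset.mul_sum]
    refine Finset.sum_le_sum fun i _ => ?_
    by_cases hi : (i : ℕ) ≤ 1
    · exact mul_le_mul_of_nonneg_right (hMa hi) (sq_nonneg _)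
    · have h1 : i ≠ i0 := by rintro rfl; simp [i0] at hi
      have h2 : i ≠ i1 := by rintro rfl; simp [i1] at hi
      rw [hv_in]; simp [h1, h2]
  have hNx : x.ofLp ⬝ᵥ N.mulVec x.ofLp ≤ lN 1 * (x.ofLp ⬝ᵥ x.ofLp) := by
    rw [aux_quad N hN lN w hw, aux_norm w, Finset.mul_sum]
    refine Finset.sum_le_sum fun i _ => ?_
    by_cases hi : i = i0
    · rw [hi, hw0]; simp
    · have : 1 ≤ (i : ℕ) := by
        by_contra hh
        exact hi (Fin.ext (by simp [i0]; omega))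
      exact mul_le_mul_of_nonneg_right (hNa this) (sq_nonneg _)
  have hf := h x.ofLp
  have := mul_le_mul_of_nonneg_left hNx hb
  have h6 : lM 1 * (x.ofLp ⬝ᵥ x.ofLp) ≤ (a + b * lN 1) * (x.ofLp ⬝ᵥ x.ofLp) := by nlinarith
  exact le_of_mul_le_mul_right h6 hxx

open scoped MatrixOrder

lemma proj_list (l : List (Matrix X X ℝ)) (hp : ∀ P ∈ l, IsStarProjection P)
    (hc : l.Pairwise Commute) :
    IsStarProjection l.prod ∧ (∀ P ∈ l, l.prod ≤ P) ∧
      1 - l.prod ≤ (l.map (fun P => 1 - P)).sum := by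
  induction l with
  | nil => simp [IsStarProjection.one]
  | cons P l ih =>
    rw [List.pairwise_cons] at hc
    obtain ⟨h1, h2, h3⟩ := ih (fun Q hQ => hp Q (List.mem_cons_of_mem _ hQ)) hc.2
    have hP := hp P List.mem_cons_self
    have hcomm : Commute P l.prod := Commute.list_prod_right _ _ hc.1
    have hmul : IsStarProjection (P * l.prod) := hP.mul h1 hcomm
    have hle1 : P * l.prod ≤ P := by
      rw [← sub_nonneg]
      refine IsStarProjection.nonneg ?_
      apply hmul.sub_of_mul_eq_left hP
      rw [mul_assoc, ← hcomm.eq, ← mul_assoc, hP.isIdempotentElem.eq]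
    have hle2 : P * l.prod ≤ l.prod := by
      rw [← sub_nonneg]
      refine IsStarProjection.nonneg ?_
      apply hmul.sub_of_mul_eq_left h1
      rw [mul_assoc, h1.isIdempotentElem.eq]
    simp only [List.prod_cons, List.map_cons, List.sum_cons]
    refine ⟨hmul, ?_, ?_⟩
    · intro Q hQ
      rcases List.mem_cons.mp hQ with rfl | hQ
      · exact hle1
      · exact hle2.trans (h2 Q hQ)
    · have h4 : 0 ≤ (1 - P) * (1 - l.prod) := by
        refine IsStarProjection.nonneg ?_
        apply hP.one_sub.mul h1.one_sub
        exact ((Commute.one_left _).sub_left ((Commute.one_right _).sub_right hcomm))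
      have h5 : (1 - P) * (1 - l.prod) = (1 - P) + (1 - l.prod) - (1 - P * l.prod) := by
        noncomm_ring
      rw [h5, sub_nonneg] at h4
      exact h4.trans (add_le_add_right h3 _)

end LinAlg

section Comb

variable {m n : ℕ} {r : Fin m → ℕ} {c : Fin n → ℕ} {F : Finset (Fin m × Fin n)}

lemma card_eq_sum_toNat {α : Type*} [Fintype α] (f : α → Bool) :
    (univ.filter fun k => f k = true).card = ∑ k, (f k).toNat := by
  rw [Finset.card_filter]
  refine Finset.sum_congr rfl fun k _ => ?_
  cases f k <;> simp

lemma inOmega_iff (A : BinMat m n) : inOmega r c F A ↔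
    (∀ i, ∑ l, (A i l).toNat = r i) ∧ (∀ l, ∑ i, (A i l).toNat = c l) ∧
      ∀ p ∈ F, A p.1 p.2 = false := by
  unfold inOmega
  simp_rw [card_eq_sum_toNat]

lemma sum_two {i j : Fin m} (hij : i ≠ j) (f : Fin m → ℕ) :
    ∑ k, f k = (∑ k ∈ univ \ {i, j}, f k) + (f i + f j) := by
  rw [← Finset.sum_sdiff (Finset.subset_univ ({i, j} : Finset (Fin m))), Finset.sum_pair hij]

lemma colpair {A B : BinMat m n} (hA : inOmega r c F A) (hB : inOmega r c F B) {i j : Fin m}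
    (hij : i ≠ j) (h : ∀ k, k ≠ i → k ≠ j → B k = A k) (l : Fin n) :
    (A i l).toNat + (A j l).toNat = (B i l).toNat + (B j l).toNat := by
  have h1 := ((inOmega_iff A).mp hA).2.1 l
  have h2 := ((inOmega_iff B).mp hB).2.1 l
  rw [sum_two hij] at h1 h2
  have h3 : ∑ k ∈ univ \ {i, j}, (A k l).toNat = ∑ k ∈ univ \ {i, j}, (B k l).toNat := by
    refine Finset.sum_congr rfl fun k hk => ?_
    simp only [mem_sdiff, mem_univ, mem_insert, mem_singleton, not_or, true_and] at hk
    rw [h k hk.1 hk.2]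
  omega

/-- agreement outside the two rows of `p` -/
def rel (p : Fin m × Fin m) (A B : BinMat m n) : Prop :=
  ∀ k, k ≠ p.1 → k ≠ p.2 → B k = A k

lemma diff_mem {A B : BinMat m n} (hA : inOmega r c F A) (hB : inOmega r c F B) {i j : Fin m}
    (hij : i ≠ j) (h : ∀ k, k ≠ i → k ≠ j → B k = A k) (l : Fin n)
    (hl : l ∉ Uset F i j A ∪ Lset F i j A) : B i l = A i l ∧ B j l = A j l := by
  have h1 := colpair hA hB hij h l
  have h2 := hB.2.2 (i, l)
  have h3 := hB.2.2 (j, l)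
  simp only [Uset, Lset, mem_union, mem_filter, mem_univ, true_and, not_or] at hl
  cases hAi : A i l <;> cases hAj : A j l <;> cases hBi : B i l <;> cases hBj : B j l <;>
    simp_all

lemma inNbhd_iff {A B : BinMat m n} (hA : inOmega r c F A) {p : Fin m × Fin m}
    (hij : p.1 ≠ p.2) :
    inNbhd r c F p.1 p.2 A B ↔ inOmega r c F B ∧ rel p A B := by
  constructor
  · rintro ⟨h1, h2⟩
    refine ⟨h1, fun k hk1 hk2 => ?_⟩
    funext l
    apply h2
    simp [hk1, hk2]
  · rintro ⟨h1, h2⟩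
    refine ⟨h1, fun k l hkl => ?_⟩
    by_cases hk1 : k = p.1
    · subst hk1
      refine (diff_mem hA h1 hij h2 l ?_).1
      simpa using hkl
    · by_cases hk2 : k = p.2
      · subst hk2
        refine (diff_mem hA h1 hij h2 l ?_).2
        simpa using hkl
      · rw [h2 k hk1 hk2]

/-- the size of the binomial neighborhood -/
def cnt (F : Finset (Fin m × Fin n)) (p : Fin m × Fin m) (A : BinMat m n) : ℕ :=
  (usize F p.1 p.2 A + lsize F p.1 p.2 A).choose (usize F p.1 p.2 A)

lemma cnt_pos (p : Fin m × Fin m) (A : BinMat m n) : 0 < cnt F p A :=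
  Nat.choose_pos (Nat.le_add_right _ _)

lemma UL_disj (i j : Fin m) (A : BinMat m n) : Disjoint (Uset F i j A) (Lset F i j A) := by
  rw [Finset.disjoint_left]
  intro l h1 h2
  simp only [Uset, Lset, mem_filter, mem_univ, true_and] at h1 h2
  simp_all

lemma sum_UL (i j : Fin m) (A : BinMat m n) :
    ∑ l ∈ Uset F i j A ∪ Lset F i j A, (A i l).toNat = usize F i j A := by
  rw [Finset.sum_union (UL_disj i j A)]
  have h1 : ∑ l ∈ Uset F i j A, (A i l).toNat = ∑ l ∈ Uset F i j A, 1 := by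
    refine Finset.sum_congr rfl fun l hl => ?_
    simp only [Uset, mem_filter] at hl
    simp [hl.2.1]
  have h2 : ∑ l ∈ Lset F i j A, (A i l).toNat = ∑ l ∈ Lset F i j A, 0 := by
    refine Finset.sum_congr rfl fun l hl => ?_
    simp only [Lset, mem_filter] at hl
    simp [hl.2.1]
  rw [h1, h2]
  simp [usize]

lemma UL_one (i j : Fin m) (A : BinMat m n) {l : Fin n}
    (hl : l ∈ Uset F i j A ∪ Lset F i j A) : (A i l).toNat + (A j l).toNat = 1 := by
  simp only [Uset, Lset, mem_union, mem_filter, mem_univ, true_and] at hl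
  rcases hl with h | h <;> simp [h.1, h.2.1]

/-- the matrix with prescribed trade set -/
def tradeMat (i j : Fin m) (W S : Finset (Fin n)) (A : BinMat m n) : BinMat m n :=
  fun k l => if l ∈ W then (if k = i then decide (l ∈ S) else
    if k = j then decide (l ∉ S) else A k l) else A k l

lemma tradeMat_mem {A : BinMat m n} (hA : inOmega r c F A) {i j : Fin m} (hij : i ≠ j)
    {S : Finset (Fin n)} (hS : S ⊆ Uset F i j A ∪ Lset F i j A) (hc : S.card = usize F i j A) :
    inOmega r c F (tradeMat i j (Uset F i j A ∪ Lset F i j A) S A) := by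
  set W := Uset F i j A ∪ Lset F i j A with hW
  set B := tradeMat i j W S A with hB
  have hA' := (inOmega_iff A).mp hA
  have hrel : ∀ k, k ≠ i → k ≠ j → B k = A k := by
    intro k h1 h2
    funext l
    simp [hB, tradeMat, h1, h2]
  have hoff : ∀ l, l ∉ W → ∀ k, B k l = A k l := by
    intro l hl k
    simp [hB, tradeMat, hl]
  have hpair : ∀ l, (B i l).toNat + (B j l).toNat = (A i l).toNat + (A j l).toNat := by
    intro l
    by_cases hl : l ∈ W
    · rw [UL_one i j A hl]
      by_cases hs : l ∈ S <;> simp [hB, tradeMat, hl, hs, hij.symm]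
    · rw [hoff l hl, hoff l hl]
  have hrowi : ∑ l, (B i l).toNat = ∑ l, (A i l).toNat := by
    rw [← Finset.sum_sdiff (Finset.subset_univ W), 
      ← Finset.sum_sdiff (Finset.subset_univ W) (f := fun l => (A i l).toNat), hW, sum_UL, ← hW]
    congr 1
    · refine Finset.sum_congr rfl fun l hl => ?_
      rw [hoff l (Finset.mem_sdiff.mp hl).2]
    · rw [← hc, ← Finset.sum_sdiff hS]
      have h1 : ∑ l ∈ S, (B i l).toNat = ∑ l ∈ S, 1 := by
        refine Finset.sum_congr rfl fun l hl => ?_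
        simp [hB, tradeMat, hl, hS hl]
      have h2 : ∑ l ∈ W \ S, (B i l).toNat = ∑ l ∈ W \ S, 0 := by
        refine Finset.sum_congr rfl fun l hl => ?_
        rw [Finset.mem_sdiff] at hl
        simp [hB, tradeMat, hl]
      rw [h1, h2]; simp
  rw [inOmega_iff]
  refine ⟨fun k => ?_, fun l => ?_, ?_⟩
  · rw [← hA'.1 k]
    by_cases h1 : k = i
    · rw [h1, hrowi]
    · by_cases h2 : k = j
      · rw [h2]
        have h3 : ∑ l, ((B i l).toNat + (B j l).toNat) = ∑ l, ((A i l).toNat + (A j l).toNat) :=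
          Finset.sum_congr rfl fun l _ => hpair l
        rw [Finset.sum_add_distrib, Finset.sum_add_distrib] at h3
        omega
      · rw [hrel k h1 h2]
  · rw [← hA'.2.1 l, sum_two hij, sum_two hij (fun k => (A k l).toNat), hpair]
    congr 1
    refine Finset.sum_congr rfl fun k hk => ?_
    simp only [mem_sdiff, mem_univ, mem_insert, mem_singleton, not_or, true_and] at hk
    rw [hrel k hk.1 hk.2]
  · rintro ⟨k, l⟩ hp
    have hk := hA.2.2 _ hp
    by_cases hl : l ∈ W
    · have hl' := hl
      simp only [hW, Uset, Lset, mem_union, mem_filter, mem_univ, true_and] at hl'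
      have h1 : k ≠ i := by
        rintro rfl
        simp_all
      have h2 : k ≠ j := by
        rintro rfl
        simp_all
      simpa [hrel k h1 h2] using hk
    · simpa [hoff l hl] using hk

lemma cnt_eq (A : OmegaType r c F) {p : Fin m × Fin m} (hp : p.1 ≠ p.2) :
    ((univ : Finset (OmegaType r c F)).filter fun B => rel p A.1 B.1).card = cnt F p A.1 := by
  obtain ⟨i, j⟩ := p
  simp only at hp
  have h0 : cnt F (i, j) A.1 = 
      ((Uset F i j A.1 ∪ Lset F i j A.1).powersetCard (usize F i j A.1)).card := by
    rw [Finset.card_powersetCard, Finset.card_union_of_disjoint (UL_disj i j A.1)]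
    rfl
  rw [h0]
  refine Finset.card_bij
    (fun B _ => (Uset F i j A.1 ∪ Lset F i j A.1).filter fun l => B.1 i l = true) ?_ ?_ ?_
  · intro B hB
    rw [Finset.mem_filter] at hB
    rw [Finset.mem_powersetCard]
    refine ⟨Finset.filter_subset _ _, ?_⟩
    have h1 : ((Uset F i j A.1 ∪ Lset F i j A.1).filter fun l => B.1 i l = true).card =
        ∑ l ∈ Uset F i j A.1 ∪ Lset F i j A.1, (B.1 i l).toNat := by
      rw [Finset.card_filter]
      refine Finset.sum_congr rfl fun k _ => ?_
      cases B.1 i k <;> simp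
    rw [h1]
    have h2 := ((inOmega_iff A.1).mp A.2).1 i
    have h3 := ((inOmega_iff B.1).mp B.2).1 i
    rw [← Finset.sum_sdiff (Finset.subset_univ (Uset F i j A.1 ∪ Lset F i j A.1))] at h2 h3
    rw [sum_UL] at h2
    have h4 : ∑ l ∈ univ \ (Uset F i j A.1 ∪ Lset F i j A.1), (B.1 i l).toNat =
        ∑ l ∈ univ \ (Uset F i j A.1 ∪ Lset F i j A.1), (A.1 i l).toNat := by
      refine Finset.sum_congr rfl fun l hl => ?_
      rw [(diff_mem A.2 B.2 hp hB.2 l (Finset.mem_sdiff.mp hl).2).1]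
    omega
  · intro B hB C hC h
    rw [Finset.mem_filter] at hB hC
    have hi : ∀ l, B.1 i l = C.1 i l := by
      intro l
      by_cases hl : l ∈ Uset F i j A.1 ∪ Lset F i j A.1
      · have h5 := congrArg (fun T => l ∈ T) h
        simp only [Finset.mem_filter, hl, true_and, eq_iff_iff] at h5
        exact Bool.eq_iff_iff.mpr h5
      · rw [(diff_mem A.2 B.2 hp hB.2 l hl).1, (diff_mem A.2 C.2 hp hC.2 l hl).1]
    apply Subtype.ext
    funext k l
    by_cases h1 : k = i
    · rw [h1, hi]
    · by_cases h2 : k = j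
      · have h3 := colpair A.2 B.2 hp hB.2 l
        have h4 := colpair A.2 C.2 hp hC.2 l
        rw [hi l] at h3
        rw [h2]
        have h5 : (B.1 j l).toNat = (C.1 j l).toNat := by omega
        revert h5
        cases B.1 j l <;> cases C.1 j l <;> simp
      · rw [hB.2 k h1 h2, hC.2 k h1 h2]
  · intro S hS
    rw [Finset.mem_powersetCard] at hS
    refine ⟨⟨_, tradeMat_mem A.2 hp hS.1 hS.2⟩, ?_, ?_⟩
    · rw [Finset.mem_filter]
      refine ⟨Finset.mem_univ _, fun k h1 h2 => ?_⟩
      funext l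
      simp only at h1 h2
      simp [tradeMat, h1, h2]
    · ext l
      rw [Finset.mem_filter]
      constructor
      · rintro ⟨h1, h2⟩
        simp only [tradeMat, if_pos h1, if_true, decide_eq_true_eq] at h2
        exact h2
      · intro h
        refine ⟨hS.1 h, ?_⟩
        simp only [tradeMat, if_pos (hS.1 h), if_true, decide_eq_true_eq]
        exact h

/-- averaging over the binomial neighborhood -/
noncomputable def Emat (r : Fin m → ℕ) (c : Fin n → ℕ) (F : Finset (Fin m × Fin n))
    (p : Fin m × Fin m) : Matrix (OmegaType r c F) (OmegaType r c F) ℝ :=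
  Matrix.of fun A B => if rel p A.1 B.1 then ((cnt F p A.1 : ℕ) : ℝ)⁻¹ else 0

lemma rel_symm {p : Fin m × Fin m} {A B : BinMat m n} (h : rel p A B) : rel p B A :=
  fun k h1 h2 => (h k h1 h2).symm

lemma rel_trans {p : Fin m × Fin m} {A B C : BinMat m n} (h : rel p A B) (h' : rel p B C) :
    rel p A C := fun k h1 h2 => (h' k h1 h2).trans (h k h1 h2)

lemma rel_refl (p : Fin m × Fin m) (A : BinMat m n) : rel p A A := fun _ _ _ => rfl

lemma cnt_rel (A B : OmegaType r c F) {p : Fin m × Fin m} (hp : p.1 ≠ p.2)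
    (h : rel p A.1 B.1) : cnt F p A.1 = cnt F p B.1 := by
  rw [← cnt_eq A hp, ← cnt_eq B hp]
  congr 1
  ext C
  simp only [Finset.mem_filter, Finset.mem_univ, true_and]
  exact ⟨fun h' => rel_trans (rel_symm h) h', fun h' => rel_trans h h'⟩

lemma Emat_proj {p : Fin m × Fin m} (hp : p.1 ≠ p.2) : IsStarProjection (Emat r c F p) := by
  constructor
  · ext A B
    rw [Matrix.mul_apply]
    simp only [Emat, Matrix.of_apply]
    by_cases h : rel p A.1 B.1
    · rw [if_pos h]
      have h1 : ∀ C : OmegaType r c F, (if rel p A.1 C.1 then ((cnt F p A.1 : ℕ) : ℝ)⁻¹ else 0) *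
          (if rel p C.1 B.1 then ((cnt F p C.1 : ℕ) : ℝ)⁻¹ else 0) =
          if rel p A.1 C.1 then ((cnt F p A.1 : ℕ) : ℝ)⁻¹ * ((cnt F p A.1 : ℕ) : ℝ)⁻¹ else 0 := by
        intro C
        by_cases h2 : rel p A.1 C.1
        · rw [if_pos h2, if_pos h2, if_pos (rel_trans (rel_symm h2) h), cnt_rel A C hp h2]
        · rw [if_neg h2, if_neg h2, zero_mul]
      rw [Finset.sum_congr rfl fun C _ => h1 C, ← Finset.sum_filter, Finset.sum_const, 
        cnt_eq A hp, nsmul_eq_mul]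
      have : (cnt F p A.1 : ℝ) ≠ 0 := by exact_mod_cast (cnt_pos p A.1).ne'
      field_simp
    · rw [if_neg h]
      refine Finset.sum_eq_zero fun C _ => ?_
      by_cases h2 : rel p A.1 C.1
      · rw [if_neg (fun h3 => h (rel_trans h2 h3)) , mul_zero]
      · rw [if_neg h2, zero_mul]
  · rw [IsSelfAdjoint, Matrix.star_eq_conjTranspose]
    ext A B
    simp only [Emat, Matrix.conjTranspose_apply, Matrix.of_apply, star_trivial]
    by_cases h : rel p A.1 B.1
    · rw [if_pos h, if_pos (rel_symm h), cnt_rel A B hp h]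
    · rw [if_neg h, if_neg (fun h' => h (rel_symm h'))]

/-- disjoint row pairs -/
def dj (p q : Fin m × Fin m) : Prop :=
  p.1 ≠ q.1 ∧ p.1 ≠ q.2 ∧ p.2 ≠ q.1 ∧ p.2 ≠ q.2

lemma dj_symm {p q : Fin m × Fin m} (h : dj p q) : dj q p :=
  ⟨h.1.symm, h.2.2.1.symm, h.2.1.symm, h.2.2.2.symm⟩

lemma cnt_dj {p q : Fin m × Fin m} (h : dj p q) {A C : BinMat m n} (hr : rel p A C) :
    cnt F q C = cnt F q A := by
  have h1 := hr q.1 h.1.symm h.2.2.1.symm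
  have h2 := hr q.2 h.2.1.symm h.2.2.2.symm
  simp only [cnt, usize, lsize, Uset, Lset, h1, h2]

lemma chain_cons {p : Fin m × Fin m} (hp : p.1 ≠ p.2) (l : List (Fin m × Fin m))
    (A : OmegaType r c F) (B : BinMat m n) :
    tradeChain r c F (p :: l) A.1 B ↔
      ∃ C : OmegaType r c F, rel p A.1 C.1 ∧ tradeChain r c F l C.1 B := by
  simp only [tradeChain]
  constructor
  · rintro ⟨C, h1, h2⟩
    rw [inNbhd_iff A.2 hp] at h1
    exact ⟨⟨C, h1.1⟩, h1.2, h2⟩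
  · rintro ⟨C, h1, h2⟩
    exact ⟨C.1, (inNbhd_iff A.2 hp).mpr ⟨C.2, h1⟩, h2⟩

lemma chain_agree (l : List (Fin m × Fin m)) (hl : ∀ p ∈ l, p.1 ≠ p.2)
    (A : OmegaType r c F) (B : BinMat m n) (h : tradeChain r c F l A.1 B) (k : Fin m)
    (hk : ∀ p ∈ l, k ≠ p.1 ∧ k ≠ p.2) : B k = A.1 k := by
  induction l generalizing A with
  | nil => simp only [tradeChain] at h; rw [h]
  | cons p l ih =>
    rw [chain_cons (hl p List.mem_cons_self)] at h
    obtain ⟨C, h1, h2⟩ := h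
    have hkp := hk p List.mem_cons_self
    rw [ih (fun q hq => hl q (List.mem_cons_of_mem _ hq)) C h2
      (fun q hq => hk q (List.mem_cons_of_mem _ hq)), h1 k hkp.1 hkp.2]

lemma Eprod_apply (l : List (Fin m × Fin m)) (hl : ∀ p ∈ l, p.1 ≠ p.2) (hd : l.Pairwise dj)
    (A B : OmegaType r c F) : (l.map (Emat r c F)).prod A B =
      if tradeChain r c F l A.1 B.1 then (((l.map fun p => cnt F p A.1).prod : ℕ) : ℝ)⁻¹ else 0 := by
  induction l generalizing A with
  | nil =>
    simp only [List.map_nil, List.prod_nil, tradeChain, Matrix.one_apply, Nat.cast_one, inv_one]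
    by_cases h : A = B
    · simp [h]
    · rw [if_neg h, if_neg (fun h' => h (Subtype.ext h'.symm))]
  | cons p l ih =>
    rw [List.pairwise_cons] at hd
    have hp := hl p List.mem_cons_self
    have hl' : ∀ q ∈ l, q.1 ≠ q.2 := fun q hq => hl q (List.mem_cons_of_mem _ hq)
    rw [List.map_cons, List.prod_cons, Matrix.mul_apply]
    simp_rw [ih hl' hd.2]
    by_cases h : tradeChain r c F (p :: l) A.1 B.1
    · rw [if_pos h]
      rw [chain_cons hp] at h
      obtain ⟨C, h1, h2⟩ := h
      rw [Finset.sum_eq_single C]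
      · rw [if_pos h2]
        simp only [Emat, Matrix.of_apply]
        rw [if_pos h1, List.map_cons, List.prod_cons]
        have : (l.map fun q => cnt F q C.1) = (l.map fun q => cnt F q A.1) :=
          List.map_congr_left fun q hq => cnt_dj (hd.1 q hq) h1
        rw [this]
        push_cast
        rw [mul_inv]
      · intro D _ hne
        simp only [Emat, Matrix.of_apply]
        by_cases h3 : rel p A.1 D.1
        · by_cases h4 : tradeChain r c F l D.1 B.1
          · exfalso
            apply hne
            apply Subtype.ext
            funext k
            by_cases hk : k = p.1 ∨ k = p.2
            · have hk' : ∀ q ∈ l, k ≠ q.1 ∧ k ≠ q.2 := by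
                intro q hq
                have := hd.1 q hq
                rcases hk with rfl | rfl
                · exact ⟨this.1, this.2.1⟩
                · exact ⟨this.2.2.1, this.2.2.2⟩
              rw [← chain_agree l hl' D B.1 h4 k hk', ← chain_agree l hl' C B.1 h2 k hk']
            · push Not at hk
              rw [h3 k hk.1 hk.2, h1 k hk.1 hk.2]
          · rw [if_neg h4, mul_zero]
        · rw [if_neg h3, zero_mul]
      · intro h; exact absurd (Finset.mem_univ _) h
    · rw [if_neg h]
      refine Finset.sum_eq_zero fun C _ => ?_
      rw [chain_cons hp] at h
      simp only [Emat, Matrix.of_apply]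
      by_cases h3 : rel p A.1 C.1
      · rw [if_neg (fun h4 => h ⟨C, h3, h4⟩), mul_zero]
      · rw [if_neg h3, zero_mul]

lemma chain_swap {p q : Fin m × Fin m} (hp : p.1 ≠ p.2) (hq : q.1 ≠ q.2) (hd : dj p q)
    (A B : OmegaType r c F) (h : tradeChain r c F [p, q] A.1 B.1) :
    tradeChain r c F [q, p] A.1 B.1 := by
  rw [chain_cons hp] at h
  obtain ⟨C, h1, h2⟩ := h
  rw [chain_cons hq] at h2
  obtain ⟨D, h2, h3⟩ := h2
  simp only [tradeChain] at h3
  have h3 : B = D := Subtype.ext h3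
  subst h3
  let C' : BinMat m n := fun k => if k = q.1 ∨ k = q.2 then B.1 k else A.1 k
  have hsum : ∀ k l, (C' k l).toNat + (C.1 k l).toNat = (A.1 k l).toNat + (B.1 k l).toNat := by
    intro k l
    by_cases hk : k = q.1 ∨ k = q.2
    · have h4 : k ≠ p.1 ∧ k ≠ p.2 := by
        rcases hk with rfl | rfl
        · exact ⟨hd.1.symm, hd.2.2.1.symm⟩
        · exact ⟨hd.2.1.symm, hd.2.2.2.symm⟩
      simp only [C', if_pos hk, h1 k h4.1 h4.2]
      omega
    · simp only [C', if_neg hk]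
      push Not at hk
      rw [h2 k hk.1 hk.2]
  have hA := (inOmega_iff A.1).mp A.2
  have hB := (inOmega_iff B.1).mp B.2
  have hC := (inOmega_iff C.1).mp C.2
  have hC' : inOmega r c F C' := by
    rw [inOmega_iff]
    refine ⟨fun k => ?_, fun l => ?_, fun x hx => ?_⟩
    · by_cases hk : k = q.1 ∨ k = q.2
      · simp only [C', if_pos hk, hB.1]
      · simp only [C', if_neg hk, hA.1]
    · have h5 : ∑ k, ((C' k l).toNat + (C.1 k l).toNat) =
          ∑ k, ((A.1 k l).toNat + (B.1 k l).toNat) := Finset.sum_congr rfl fun k _ => hsum k l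
      rw [Finset.sum_add_distrib, Finset.sum_add_distrib, hA.2.1, hB.2.1, hC.2.1] at h5
      omega
    · by_cases hk : x.1 = q.1 ∨ x.1 = q.2
      · simp only [C', if_pos hk, hB.2.2 x hx]
      · simp only [C', if_neg hk, hA.2.2 x hx]
  rw [chain_cons hq]
  refine ⟨⟨C', hC'⟩, fun k k1 k2 => ?_, ?_⟩
  · simp [C', k1, k2]
  · rw [chain_cons hp]
    refine ⟨B, fun k k1 k2 => ?_, rfl⟩
    by_cases hk : k = q.1 ∨ k = q.2
    · simp only [C', if_pos hk]
    · simp only [C', if_neg hk]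
      push Not at hk
      rw [h2 k hk.1 hk.2, h1 k k1 k2]

lemma Emat_comm {p q : Fin m × Fin m} (hp : p.1 ≠ p.2) (hq : q.1 ≠ q.2) (hd : dj p q) :
    Commute (Emat r c F p) (Emat r c F q) := by
  have h1 : ∀ A B, (Emat r c F p * Emat r c F q) A B = (Emat r c F q * Emat r c F p) A B := by
    intro A B
    have e1 := Eprod_apply (r := r) (c := c) (F := F) [p, q] (by simp [hp, hq]) (by simp [hd]) A B
    have e2 := Eprod_apply (r := r) (c := c) (F := F) [q, p] (by simp [hp, hq])
      (by simp [dj_symm hd]) A B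
    simp only [List.map_cons, List.map_nil, List.prod_cons, List.prod_nil, mul_one] at e1 e2
    rw [e1, e2]
    by_cases h : tradeChain r c F [p, q] A.1 B.1
    · rw [if_pos h, if_pos (chain_swap hp hq hd A B h), mul_comm]
    · rw [if_neg h, if_neg (fun h' => h (chain_swap hq hp (dj_symm hd) A B h'))]
  ext A B
  exact h1 A B

lemma kPair_props {k : ℕ} {κ : Finset (Fin m × Fin m)} (hκ : κ ∈ kPairSets m k) :
    κ.card = k ∧ (∀ p ∈ κ, p.1 ≠ p.2) ∧ ∀ p ∈ κ, ∀ q ∈ κ, p ≠ q → dj p q := by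
  simp only [kPairSets, mem_filter, mem_univ, true_and] at hκ
  refine ⟨hκ.1, fun p hp => (hκ.2.1 p hp).ne, fun p hp q hq hne => ?_⟩
  have h := hκ.2.2 p hp q hq hne
  have h1 : ∀ x, x ∈ ({p.1, p.2} : Finset (Fin m)) → x ∉ ({q.1, q.2} : Finset (Fin m)) := by
    intro x hx hx'
    have : x ∈ (∅ : Finset (Fin m)) := by rw [← h]; exact Finset.mem_inter.mpr ⟨hx, hx'⟩
    simp at this
  have a1 := h1 p.1 (by simp)
  have a2 := h1 p.2 (by simp)
  simp only [mem_insert, mem_singleton, not_or] at a1 a2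
  exact ⟨a1.1, a1.2, a2.1, a2.2⟩

lemma list_dj {k : ℕ} {κ : Finset (Fin m × Fin m)} (hκ : κ ∈ kPairSets m k)
    {l : List (Fin m × Fin m)} (hn : l.Nodup) (hl : l.toFinset = κ) :
    (∀ p ∈ l, p.1 ≠ p.2) ∧ l.Pairwise dj := by
  obtain ⟨-, h1, h2⟩ := kPair_props hκ
  have hm : ∀ p, p ∈ l → p ∈ κ := fun p hp => by rw [← hl]; exact List.mem_toFinset.mpr hp
  refine ⟨fun p hp => h1 p (hm p hp), ?_⟩
  exact List.Pairwise.imp_of_mem (fun ha hb hab => h2 _ (hm _ ha) _ (hm _ hb) hab) hn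

lemma list_comm {l : List (Fin m × Fin m)} (hl : ∀ p ∈ l, p.1 ≠ p.2) (hd : l.Pairwise dj) :
    (l.map (Emat r c F)).Pairwise Commute := by
  rw [List.pairwise_map]
  exact List.Pairwise.imp_of_mem (fun ha hb hab => Emat_comm (hl _ ha) (hl _ hb) hab) hd

lemma kNbhd_iff {k : ℕ} {κ : Finset (Fin m × Fin m)} (hκ : κ ∈ kPairSets m k)
    (A B : OmegaType r c F) :
    inKNbhd r c F κ A.1 B.1 ↔ tradeChain r c F κ.toList A.1 B.1 := by
  constructor
  · rintro ⟨l, hn, hl, h⟩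
    obtain ⟨h1, h2⟩ := list_dj hκ hn hl
    obtain ⟨h1', h2'⟩ := list_dj hκ κ.nodup_toList κ.toList_toFinset
    have hperm : l.Perm κ.toList := by
      rw [List.perm_ext_iff_of_nodup hn κ.nodup_toList]
      intro a
      rw [Finset.mem_toList, ← hl, List.mem_toFinset]
    have he := (hperm.map (Emat r c F)).prod_eq' (list_comm h1 h2)
    have he' := congrFun (congrFun he A) B
    rw [Eprod_apply l h1 h2, Eprod_apply _ h1' h2', if_pos h] at he'
    by_contra hcon
    rw [if_neg hcon, inv_eq_zero, Nat.cast_eq_zero, List.prod_eq_zero_iff] at he'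
    simp only [List.mem_map] at he'
    obtain ⟨p, -, hp⟩ := he'
    exact (cnt_pos p A.1).ne' hp
  · intro h
    exact ⟨κ.toList, κ.nodup_toList, κ.toList_toFinset, h⟩

lemma PkCurve_eq (k : ℕ) : PkCurve r c F k =
    ((kPairSets m k).card : ℝ)⁻¹ • ∑ κ ∈ kPairSets m k, (κ.toList.map (Emat r c F)).prod := by
  ext A B
  rw [Matrix.smul_apply, Matrix.sum_apply, smul_eq_mul, Finset.mul_sum]
  simp only [PkCurve, Matrix.of_apply]
  refine Finset.sum_congr rfl fun κ hκ => ?_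
  obtain ⟨h1', h2'⟩ := list_dj hκ κ.nodup_toList κ.toList_toFinset
  rw [Eprod_apply _ h1' h2', Finset.prod_map_toList]
  by_cases h : inKNbhd r c F κ A.1 B.1
  · rw [if_pos h, if_pos ((kNbhd_iff hκ A B).mp h)]
    rfl
  · rw [if_neg h, if_neg (fun h' => h ((kNbhd_iff hκ A B).mpr h')), mul_zero]

lemma Pcurve_eq : Pcurve r c F =
    (m.choose 2 : ℝ)⁻¹ • ∑ p ∈ rowPairs m, Emat r c F p := by
  ext A B
  rw [Matrix.smul_apply, Matrix.sum_apply, smul_eq_mul]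
  simp only [Pcurve, Matrix.of_apply]
  by_cases h : A = B
  · rw [if_pos h]
    subst h
    congr 1
    refine Finset.sum_congr rfl fun p _ => ?_
    simp only [Emat, Matrix.of_apply]
    rw [if_pos (rel_refl _ _)]
    rfl
  · rw [if_neg h, Finset.mul_sum]
    refine Finset.sum_congr rfl fun p hp => ?_
    have hp' : p.1 ≠ p.2 := by
      simp only [rowPairs, mem_filter, mem_univ, true_and] at hp
      exact hp.ne
    simp only [Emat, Matrix.of_apply, inNbhd_iff A.2 hp', B.2, true_and]
    by_cases h2 : rel p A.1 B.1
    · rw [if_pos h2, if_pos h2]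
      rfl
    · rw [if_neg h2, if_neg h2, mul_zero]

end Comb

section Count

variable {m : ℕ}

/-- the increasing pair given by the image of a pair under a permutation -/
def sp (σ : Equiv.Perm (Fin m)) (p : Fin m × Fin m) : Fin m × Fin m :=
  if σ p.1 < σ p.2 then (σ p.1, σ p.2) else (σ p.2, σ p.1)

lemma sp_lt (σ : Equiv.Perm (Fin m)) {p : Fin m × Fin m} (h : p.1 < p.2) :
    (sp σ p).1 < (sp σ p).2 := by
  unfold sp
  split_ifs with h1
  · exact h1
  · exact lt_of_le_of_ne (not_lt.mp h1) (fun h2 => h.ne' (σ.injective h2))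

lemma sp_inv (σ : Equiv.Perm (Fin m)) {p : Fin m × Fin m} (h : p.1 < p.2) :
    sp σ⁻¹ (sp σ p) = p := by
  unfold sp
  by_cases h1 : σ p.1 < σ p.2
  · simp [h1, h]
  · simp [h1, h.le]

lemma sp_set (σ : Equiv.Perm (Fin m)) (p : Fin m × Fin m) :
    ({(sp σ p).1, (sp σ p).2} : Finset (Fin m)) = ({p.1, p.2} : Finset (Fin m)).image σ := by
  unfold sp
  split_ifs
  · simp [Finset.image_insert]
  · simp [Finset.image_insert, Finset.pair_comm]

lemma image_sp_inv (σ : Equiv.Perm (Fin m)) {κ : Finset (Fin m × Fin m)}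
    (h : ∀ p ∈ κ, p.1 < p.2) : (κ.image (sp σ)).image (sp σ⁻¹) = κ := by
  rw [Finset.image_image]
  have : κ.image (sp σ⁻¹ ∘ sp σ) = κ.image id :=
    Finset.image_congr fun p hp => sp_inv σ (h p hp)
  rw [this, Finset.image_id]

lemma image_sp_mem (σ : Equiv.Perm (Fin m)) {k : ℕ} {κ : Finset (Fin m × Fin m)}
    (h : κ ∈ kPairSets m k) : κ.image (sp σ) ∈ kPairSets m k := by
  simp only [kPairSets, mem_filter, mem_univ, true_and] at h ⊢
  obtain ⟨h1, h2, h3⟩ := h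
  refine ⟨?_, ?_, ?_⟩
  · rw [Finset.card_image_of_injOn, h1]
    intro p hp q hq hpq
    rw [← sp_inv σ (h2 p hp), ← sp_inv σ (h2 q hq), hpq]
  · intro p hp
    obtain ⟨q, hq, rfl⟩ := Finset.mem_image.mp hp
    exact sp_lt σ (h2 q hq)
  · intro p hp q hq hne
    obtain ⟨p, hp1, rfl⟩ := Finset.mem_image.mp hp
    obtain ⟨q, hq1, rfl⟩ := Finset.mem_image.mp hq
    have h4 := h3 p hp1 q hq1 (fun h => hne (by rw [h]))
    rw [sp_set, sp_set, ← Finset.image_inter _ _ σ.injective, h4, Finset.image_empty]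

lemma deg_le_s14 (k : ℕ) {p p' : Fin m × Fin m} (hp : p.1 < p.2) (hp' : p'.1 < p'.2) :
    ((kPairSets m k).filter fun κ => p ∈ κ).card ≤
      ((kPairSets m k).filter fun κ => p' ∈ κ).card := by
  obtain ⟨σ, h1, h2⟩ : ∃ σ : Equiv.Perm (Fin m), σ p.1 = p'.1 ∧ σ p.2 = p'.2 := by
    have hne : Equiv.swap p.1 p'.1 p.2 ≠ p'.1 := by
      intro h
      rw [← Equiv.swap_apply_left p.1 p'.1] at h
      exact hp.ne' ((Equiv.swap p.1 p'.1).injective (by simpa using h))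
    refine ⟨Equiv.swap (Equiv.swap p.1 p'.1 p.2) p'.2 * Equiv.swap p.1 p'.1, ?_, ?_⟩
    · rw [Equiv.Perm.mul_apply, Equiv.swap_apply_left,
        Equiv.swap_apply_of_ne_of_ne hne.symm hp'.ne]
    · rw [Equiv.Perm.mul_apply, Equiv.swap_apply_left]
  have hs : sp σ p = p' := by
    unfold sp
    rw [h1, h2, if_pos hp']
  refine Finset.card_le_card_of_injOn (fun κ => κ.image (sp σ)) ?_ ?_
  · intro κ hκ
    simp only [coe_filter, Set.mem_ofPred_eq] at hκ ⊢
    exact ⟨image_sp_mem σ hκ.1, Finset.mem_image.mpr ⟨p, hκ.2, hs⟩⟩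
  · intro κ hκ κ' hκ' h
    simp only [coe_filter, Set.mem_ofPred_eq] at hκ hκ'
    have a1 := hκ.1
    have a2 := hκ'.1
    simp only [kPairSets, mem_filter, mem_univ, true_and] at a1 a2
    rw [← image_sp_inv σ a1.2.1, ← image_sp_inv σ a2.2.1]
    simp only at h
    rw [h]

lemma card_rowPairs_s14 : (rowPairs m).card = m.choose 2 := by
  have h1 : (rowPairs m).card = ∑ j : Fin m, (j : ℕ) := by
    rw [rowPairs, Finset.card_filter, Fintype.sum_prod_type_right]
    refine Finset.sum_congr rfl fun j _ => ?_
    simp only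
    rw [← Finset.card_filter]
    have : (univ.filter fun i : Fin m => i < j) = Finset.Iio j := by ext; simp
    rw [this, Fin.card_Iio]
  rw [h1, Fin.sum_univ_eq_sum_range (fun i => i) m, Finset.sum_range_id, Nat.choose_two_right]

lemma double_count (k : ℕ) (hm : 2 ≤ m) : ∃ d : ℕ, d * m.choose 2 = k * (kPairSets m k).card ∧
    ∀ (V : Type) [AddCommMonoid V] (f : Fin m × Fin m → V),
      ∑ κ ∈ kPairSets m k, ∑ p ∈ κ, f p = d • ∑ p ∈ rowPairs m, f p := by
  let p0 : Fin m × Fin m := (⟨0, by omega⟩, ⟨1, by omega⟩)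
  have hp0 : p0.1 < p0.2 := by simp [p0]
  have key : ∀ (V : Type) [AddCommMonoid V] (f : Fin m × Fin m → V),
      ∑ κ ∈ kPairSets m k, ∑ p ∈ κ, f p =
        ((kPairSets m k).filter fun κ => p0 ∈ κ).card • ∑ p ∈ rowPairs m, f p := by
    intro V _ f
    rw [Finset.sum_comm' (t' := rowPairs m) (s' := fun p => (kPairSets m k).filter fun κ => p ∈ κ),
      Finset.smul_sum]
    · refine Finset.sum_congr rfl fun p hp => ?_
      simp only [rowPairs, mem_filter, mem_univ, true_and] at hp
      rw [Finset.sum_const, le_antisymm (deg_le_s14 k hp hp0) (deg_le_s14 k hp0 hp)]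
    · intro κ p
      rw [Finset.mem_filter]
      constructor
      · rintro ⟨h1, h2⟩
        refine ⟨⟨h1, h2⟩, ?_⟩
        simp only [kPairSets, rowPairs, mem_filter, mem_univ, true_and] at h1 ⊢
        exact h1.2.1 p h2
      · rintro ⟨h1, -⟩
        exact h1
  refine ⟨_, ?_, key⟩
  have h1 := key ℕ (fun _ => 1)
  simp only [Finset.sum_const, smul_eq_mul, mul_one] at h1
  rw [card_rowPairs_s14] at h1
  rw [← h1, Finset.sum_congr rfl (fun κ hκ => (kPair_props hκ).1), Finset.sum_const, smul_eq_mul,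
    mul_comm]

end Count

section Main

open scoped MatrixOrder

lemma quad_mono {X : Type*} [Fintype X] [DecidableEq X] {M N : Matrix X X ℝ} (h : M ≤ N)
    (v : X → ℝ) : v ⬝ᵥ M.mulVec v ≤ v ⬝ᵥ N.mulVec v := by
  have h1 := (Matrix.le_iff.mp h).dotProduct_mulVec_nonneg v
  rw [star_trivial, Matrix.sub_mulVec, dotProduct_sub] at h1
  linarith

variable {m n : ℕ} (r : Fin m → ℕ) (c : Fin n → ℕ) (F : Finset (Fin m × Fin n)) (k : ℕ)

lemma mat_bounds (hm : 2 ≤ m) (hL : 0 < (kPairSets m k).card) :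
    (kPairSets m k).card • (1 - PkCurve r c F k) ≤
        (k * (kPairSets m k).card) • (1 - Pcurve r c F) ∧
    (k * (kPairSets m k).card) • (1 - Pcurve r c F) ≤
        (k * (kPairSets m k).card) • (1 - PkCurve r c F k) := by
  obtain ⟨d, hd, hsum⟩ := double_count (m := m) k hm
  have hK : 0 < m.choose 2 := Nat.choose_pos hm
  have hS := hsum (Matrix (OmegaType r c F) (OmegaType r c F) ℝ) (fun p => 1 - Emat r c F p)
  have hc1 : m.choose 2 • (1 - Pcurve r c F) = ∑ p ∈ rowPairs m, (1 - Emat r c F p) := by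
    rw [Finset.sum_sub_distrib, Finset.sum_const, card_rowPairs_s14, smul_sub, Pcurve_eq]
    congr 1
    rw [← Nat.cast_smul_eq_nsmul ℝ, smul_smul, mul_inv_cancel₀ (by exact_mod_cast hK.ne'), one_smul]
  have hk1 : (kPairSets m k).card • (1 - PkCurve r c F k) =
      ∑ κ ∈ kPairSets m k, (1 - (κ.toList.map (Emat r c F)).prod) := by
    rw [Finset.sum_sub_distrib, Finset.sum_const, smul_sub, PkCurve_eq]
    congr 1
    rw [← Nat.cast_smul_eq_nsmul ℝ, smul_smul, mul_inv_cancel₀ (by exact_mod_cast hL.ne'), one_smul]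
  rw [← hc1, smul_smul, hd] at hS
  have hproj : ∀ κ ∈ kPairSets m k, (∀ p ∈ κ, (κ.toList.map (Emat r c F)).prod ≤ Emat r c F p) ∧
      1 - (κ.toList.map (Emat r c F)).prod ≤ ∑ p ∈ κ, (1 - Emat r c F p) := by
    intro κ hκ
    obtain ⟨h1, h2⟩ := list_dj hκ κ.nodup_toList κ.toList_toFinset
    obtain ⟨-, h3, h4⟩ := proj_list (κ.toList.map (Emat r c F)) (by
      intro P hP
      obtain ⟨p, hp, rfl⟩ := List.mem_map.mp hP
      exact Emat_proj (h1 p hp)) (list_comm h1 h2)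
    refine ⟨fun p hp => h3 _ (List.mem_map_of_mem (Finset.mem_toList.mpr hp)), ?_⟩
    rw [List.map_map] at h4
    refine h4.trans (le_of_eq ?_)
    exact Finset.sum_map_toList κ (fun p => 1 - Emat r c F p)
  rw [← hS, mul_smul, hk1]
  refine ⟨Finset.sum_le_sum fun κ hκ => (hproj κ hκ).2, ?_⟩
  rw [Finset.smul_sum]
  refine Finset.sum_le_sum fun κ hκ => ?_
  have h5 := Finset.sum_le_card_nsmul κ (fun p => 1 - Emat r c F p)
    (1 - (κ.toList.map (Emat r c F)).prod) (fun p hp => sub_le_sub_left ((hproj κ hκ).1 p hp) 1)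
  rwa [(kPair_props hκ).1] at h5

lemma Pcurve_herm : (Pcurve r c F).IsHermitian := by
  change IsSelfAdjoint (Pcurve r c F)
  rw [Pcurve_eq]
  refine IsSelfAdjoint.smul (IsSelfAdjoint.all _) (isSelfAdjoint_sum _ fun p hp => ?_)
  simp only [rowPairs, mem_filter, mem_univ, true_and] at hp
  exact (Emat_proj hp.ne).isSelfAdjoint

lemma PkCurve_herm : (PkCurve r c F k).IsHermitian := by
  change IsSelfAdjoint (PkCurve r c F k)
  rw [PkCurve_eq]
  refine IsSelfAdjoint.smul (IsSelfAdjoint.all _) (isSelfAdjoint_sum _ fun κ hκ => ?_)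
  obtain ⟨h1, h2⟩ := list_dj hκ κ.nodup_toList κ.toList_toFinset
  refine (proj_list (κ.toList.map (Emat r c F)) ?_ (list_comm h1 h2)).1.isSelfAdjoint
  intro P hP
  obtain ⟨p, hp, rfl⟩ := List.mem_map.mp hP
  exact Emat_proj (h1 p hp)

end Main

/-- for `1 ≤ k ≤ ⌊m/2⌋`, if the Curveball chain and the `k`-Curveball
chain on `Ω(r,c,F)` are both ergodic then
`(1/k)·(1 - λ_*^c)⁻¹ ≤ (1 - λ_*^{k,c})⁻¹ ≤ (1 - λ_*^c)⁻¹`, where `λ_*` denotes in each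
case the second-largest eigenvalue (given by antitone enumerations of the eigenvalues). -/
theorem stmt_14 {m n : ℕ} (r : Fin m → ℕ) (c : Fin n → ℕ) (F : Finset (Fin m × Fin n))
    (k : ℕ) (hk : 1 ≤ k) (hkm : k ≤ m / 2)
    (hcard : 2 ≤ Fintype.card (OmegaType r c F))
    (hergC : ∃ T : ℕ, ∀ t ≥ T, ∀ A B : OmegaType r c F, 0 < ((Pcurve r c F) ^ t) A B)
    (hergK : ∃ T : ℕ, ∀ t ≥ T, ∀ A B : OmegaType r c F, 0 < ((PkCurve r c F k) ^ t) A B)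
    (lamC lamK : ℕ → ℝ)
    (hCanti : Antitone lamC) (hC0 : lamC 0 = 1)
    (hCroots : (Pcurve r c F).charpoly.roots
      = (Multiset.range (Fintype.card (OmegaType r c F))).map lamC)
    (hKanti : Antitone lamK) (hK0 : lamK 0 = 1)
    (hKroots : (PkCurve r c F k).charpoly.roots
      = (Multiset.range (Fintype.card (OmegaType r c F))).map lamK) :
    (1 / (k : ℝ)) * (1 - lamC 1)⁻¹ ≤ (1 - lamK 1)⁻¹ ∧
    (1 - lamK 1)⁻¹ ≤ (1 - lamC 1)⁻¹ := by
  have hm : 2 ≤ m := by omega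
  have hL : 0 < (kPairSets m k).card := by
    by_contra hcon
    have h0 : kPairSets m k = ∅ := by
      rw [← Finset.card_eq_zero]
      omega
    obtain ⟨T, hT⟩ := hergK
    have hne : 0 < Fintype.card (OmegaType r c F) := by omega
    obtain ⟨A⟩ := Fintype.card_pos_iff.mp hne
    have h1 := hT (T + 1) (Nat.le_succ T) A A
    have h2 : PkCurve r c F k = 0 := by
      rw [PkCurve_eq, h0]
      simp
    rw [h2, zero_pow (Nat.succ_ne_zero T)] at h1
    simp at h1
  obtain ⟨hb1, hb2⟩ := mat_bounds r c F k hm hL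
  have hkpos : (0 : ℝ) < k := by exact_mod_cast hk
  have hLpos : (0 : ℝ) < (kPairSets m k).card := by exact_mod_cast hL
  have q1 : ∀ v : OmegaType r c F → ℝ, v ⬝ᵥ (Pcurve r c F).mulVec v ≤
      ((k - 1) / k : ℝ) * (v ⬝ᵥ v) + (1 / k : ℝ) * (v ⬝ᵥ (PkCurve r c F k).mulVec v) := by
    intro v
    have h := quad_mono hb1 v
    rw [← Nat.cast_smul_eq_nsmul ℝ, ← Nat.cast_smul_eq_nsmul ℝ] at h
    simp only [Matrix.smul_mulVec, Matrix.sub_mulVec, Matrix.one_mulVec, dotProduct_smul,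
      dotProduct_sub, smul_eq_mul, Nat.cast_mul] at h
    rw [mul_comm (k : ℝ), mul_assoc] at h
    have h' := le_of_mul_le_mul_left h hLpos
    have h3 : ((k - 1) / k : ℝ) * (v ⬝ᵥ v) + (1 / k : ℝ) * (v ⬝ᵥ (PkCurve r c F k).mulVec v) =
      ((k - 1) * (v ⬝ᵥ v) + (v ⬝ᵥ (PkCurve r c F k).mulVec v)) / k := by ring
    rw [h3, le_div_iff₀ hkpos]
    linarith
  have q2 : ∀ v : OmegaType r c F → ℝ, v ⬝ᵥ (PkCurve r c F k).mulVec v ≤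
      0 * (v ⬝ᵥ v) + 1 * (v ⬝ᵥ (Pcurve r c F).mulVec v) := by
    intro v
    have h := quad_mono hb2 v
    rw [← Nat.cast_smul_eq_nsmul ℝ, ← Nat.cast_smul_eq_nsmul ℝ] at h
    simp only [Matrix.smul_mulVec, Matrix.sub_mulVec, Matrix.one_mulVec, dotProduct_smul,
      dotProduct_sub, smul_eq_mul, Nat.cast_mul] at h
    have h' := le_of_mul_le_mul_left h (mul_pos hkpos hLpos)
    linarith
  have e1 := second_le _ _ (Pcurve_herm r c F) (PkCurve_herm r c F k) hcard lamC lamK hCanti hKanti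
    hCroots hKroots _ _ (by positivity) q1
  have e2 := second_le _ _ (PkCurve_herm r c F k) (Pcurve_herm r c F) hcard lamK lamC hKanti hCanti
    hKroots hCroots _ _ (by norm_num) q2
  have hC1 : lamC 1 ≤ 1 := by rw [← hC0]; exact hCanti (Nat.zero_le 1)
  have e3 : 1 - lamK 1 ≤ k * (1 - lamC 1) := by
    have h3 : ((k - 1) / k : ℝ) + (1 / k : ℝ) * lamK 1 = ((k - 1) + lamK 1) / k := by ring
    rw [h3, le_div_iff₀ hkpos] at e1
    linarith
  rcases hC1.lt_or_eq with hlt | heq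
  · have hpos : 0 < 1 - lamC 1 := by linarith
    have hposK : 0 < 1 - lamK 1 := by linarith
    constructor
    · rw [one_div, ← mul_inv]
      exact inv_anti₀ hposK e3
    · exact inv_anti₀ hpos (by linarith)
  · have hK1 : lamK 1 = 1 := by
      rw [heq] at e2 e3
      linarith
    rw [heq, hK1]
    simp
end
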